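/- arXiv:math/0404084 — 3 statements merged into one kernel-verified Lean document; each statement's English description precedes it below -/
import Mathlib

section
/- Let Z be a random variable taking values in the positive integers on a probability space (Ω, F, P), and let (F_n)_{n≥0} be a filtration. Define Y = Σ_{n=0}^∞ P(Z = n+1 | F_n). Then E[Y] = 1 and, for every real λ > 0, E[(Y − λ)^+] ≤ e^{-λ}. -/
open MeasureTheory Filter Set
open scoped ENNReal

/-- The terms whose partial sums stay below `l` contribute at most `l` to a series. -/
lemma ENNReal.tsum_le_add_tsum_ite_lt_sum_range (b : ℕ → ℝ≥0∞) (l : ℝ≥0∞) :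
    ∑' k, b k ≤ l + ∑' k, if l < ∑ i ∈ Finset.range (k + 1), b i then b k else 0 := by
  have hsplit : ∀ k, b k = (if l < ∑ i ∈ Finset.range (k + 1), b i then 0 else b k) +
      (if l < ∑ i ∈ Finset.range (k + 1), b i then b k else 0) := by
    intro k
    split_ifs <;> simp
  rw [tsum_congr hsplit, ENNReal.tsum_add]
  gcongr
  refine ENNReal.tsum_le_of_sum_range_le fun n => ?_
  induction n with
  | zero => simp
  | succ n ih =>
    rw [Finset.sum_range_succ]
    split_ifs with h
    · simpa using ih
    · rw [not_lt, Finset.sum_range_succ] at h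
      refine le_trans ?_ h
      gcongr with i
      split_ifs <;> simp

/-- The defining property of a conditional probability, as a lower Lebesgue integral. -/
lemma setLIntegral_ofReal_condExp_indicator_one {Ω : Type*} {m₀ m : MeasurableSpace Ω}
    (μ : Measure Ω) [IsFiniteMeasure μ] (hm : m₀ ≤ m) {A B : Set Ω}
    (hA : MeasurableSet[m₀] A) (hB : MeasurableSet B) :
    ∫⁻ ω in A, ENNReal.ofReal ((μ[B.indicator (fun _ => (1 : ℝ)) | m₀]) ω) ∂μ = μ (B ∩ A) := by
  have hint : Integrable (B.indicator (fun _ => (1 : ℝ))) μ :=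
    (integrable_const 1).indicator hB
  have hnonneg : 0 ≤ᵐ[μ] μ[B.indicator (fun _ => (1 : ℝ)) | m₀] :=
    condExp_nonneg (Eventually.of_forall fun ω => indicator_nonneg (fun _ _ => zero_le_one) ω)
  rw [← ofReal_integral_eq_lintegral_ofReal integrable_condExp.integrableOn
    (ae_restrict_of_ae hnonneg), setIntegral_condExp hm hint hA, integral_indicator hB]
  simp [Measure.real, Measure.restrict_apply hB]

/-- If the stop-loss transform of `V` is dominated by its tail, it decays at least as fast as
that of an exponential variable. -/
lemma lintegral_tsub_le_exp_neg {Ω : Type*} {m : MeasurableSpace Ω} (μ : Measure Ω)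
    {V : Ω → ℝ≥0∞} (hV : Measurable V) (hmean : ∫⁻ ω, V ω ∂μ ≤ 1)
    (htail : ∀ l : ℝ≥0∞, l ≠ ∞ → ∫⁻ ω, (V ω - l) ∂μ ≤ μ {ω | l < V ω})
    {l : ℝ} (hl : 0 < l) :
    ∫⁻ ω, (V ω - ENNReal.ofReal l) ∂μ ≤ ENNReal.ofReal (Real.exp (-l)) := by
  have hstep : ∀ a h : ℝ≥0∞, a ≠ ∞ → h ≠ ∞ →
      (1 + h) * ∫⁻ ω, (V ω - (a + h)) ∂μ ≤ ∫⁻ ω, (V ω - a) ∂μ := by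
    intro a h ha hh
    have hset : MeasurableSet {ω | a + h < V ω} := measurableSet_lt measurable_const hV
    calc (1 + h) * ∫⁻ ω, (V ω - (a + h)) ∂μ
        ≤ ∫⁻ ω, (V ω - (a + h)) ∂μ + h * μ {ω | a + h < V ω} := by
          rw [add_mul, one_mul]
          gcongr
          exact htail _ (ENNReal.add_ne_top.2 ⟨ha, hh⟩)
      _ = ∫⁻ ω, (V ω - (a + h)) + {ω | a + h < V ω}.indicator (fun _ => h) ω ∂μ := by
          rw [lintegral_add_left (hV.sub_const (a + h)), lintegral_indicator_const hset]
      _ ≤ ∫⁻ ω, (V ω - a) ∂μ := by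
          refine lintegral_mono fun ω => ?_
          by_cases hω : a + h < V ω
          · rw [indicator_of_mem (by exact hω), ← tsub_tsub]
            exact (tsub_add_cancel_of_le
              (ENNReal.le_sub_of_add_le_left ha hω.le)).le
          · rw [indicator_of_notMem (by exact hω), tsub_eq_zero_of_le (not_lt.1 hω)]
            simp
  have hiter : ∀ h : ℝ≥0∞, h ≠ ∞ → ∀ n : ℕ, (1 + h) ^ n * ∫⁻ ω, (V ω - n * h) ∂μ ≤ 1 := by
    intro h hh n
    induction n with
    | zero => simpa using hmean
    | succ n ih =>
      refine le_trans ?_ ih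
      rw [pow_succ, mul_assoc]
      gcongr
      have := hstep (n * h) h (ENNReal.mul_ne_top (by simp) hh) hh
      simpa [add_mul] using this
  set g := ∫⁻ ω, (V ω - ENNReal.ofReal l) ∂μ with hg
  have hg1 : g ≤ 1 := (lintegral_mono fun ω => tsub_le_self).trans hmean
  have hg_top : g ≠ ∞ := ne_top_of_le_ne_top ENNReal.one_ne_top hg1
  have hbound : ∀ᶠ n : ℕ in atTop, (1 + l / n) ^ n * g.toReal ≤ 1 := by
    filter_upwards [eventually_gt_atTop 0] with n hn
    have hn' : (0 : ℝ) < n := by exact_mod_cast hn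
    have hln : (0 : ℝ) ≤ l / n := by positivity
    have h1 := hiter (ENNReal.ofReal (l / n)) ENNReal.ofReal_ne_top n
    have h2 : (n : ℝ≥0∞) * ENNReal.ofReal (l / n) = ENNReal.ofReal l := by
      rw [← ENNReal.ofReal_natCast, ← ENNReal.ofReal_mul hn'.le]
      congr 1
      field_simp
    rw [h2, ← hg] at h1
    have h3 := ENNReal.toReal_mono ENNReal.one_ne_top h1
    rwa [ENNReal.toReal_mul, ENNReal.toReal_pow,
      ENNReal.toReal_add ENNReal.one_ne_top ENNReal.ofReal_ne_top,
      ENNReal.toReal_ofReal hln, ENNReal.toReal_one] at h3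
  have hlim : Real.exp l * g.toReal ≤ 1 :=
    le_of_tendsto ((Real.tendsto_one_add_div_pow_exp l).mul_const _) hbound
  rw [ENNReal.le_ofReal_iff_toReal_le hg_top (Real.exp_pos _).le, Real.exp_neg,
    ← one_div, le_div_iff₀ (Real.exp_pos l), mul_comm]
  exact hlim

/-- **Total risk, discrete case: mean and stop-loss bounds.**
Let `Z` be a random positive integer and `ℱ` a filtration.  Let
`Y = ∑_{n=0}^∞ P(Z = n+1 | ℱ n)`.  Then `E[Y] = 1` and, for every real `λ > 0`,
`E[(Y − λ)⁺] ≤ e^{-λ}`.  Since `Y ≥ 0` (a.e.) and `(Y − λ)⁺ ≥ 0`, the expectations are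
expressed as lower Lebesgue integrals. -/
theorem total_risk_discrete_mean_and_stop_loss
    {Ω : Type*} {m : MeasurableSpace Ω} (μ : Measure Ω) [IsProbabilityMeasure μ]
    (ℱ : Filtration ℕ m) (Z : Ω → ℕ) (hZmeas : Measurable Z) (hZpos : ∀ ω, 0 < Z ω)
    (Y : Ω → ℝ)
    (hY : Y = fun ω =>
      ∑' n : ℕ, (μ[Set.indicator {ω' | Z ω' = n + 1} (fun _ => (1 : ℝ)) | ℱ n]) ω) :
    (∫⁻ ω, ENNReal.ofReal (Y ω) ∂μ) = 1 ∧
      ∀ l : ℝ, 0 < l →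
        (∫⁻ ω, ENNReal.ofReal (max (Y ω - l) 0) ∂μ) ≤ ENNReal.ofReal (Real.exp (-l)) := by
  set B : ℕ → Set Ω := fun n => {ω | Z ω = n + 1} with hBdef
  set a : ℕ → Ω → ℝ := fun n => μ[(B n).indicator (fun _ => (1 : ℝ)) | ℱ n] with hadef
  set V : Ω → ℝ≥0∞ := fun ω => ∑' n, ENNReal.ofReal (a n ω) with hVdef
  have hB : ∀ n, MeasurableSet (B n) := fun n => hZmeas (measurableSet_singleton (n + 1))
  have hBdisj : Pairwise (Function.onFun Disjoint B) := by
    intro i j hij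
    refine Set.disjoint_left.2 fun ω (hi : Z ω = i + 1) (hj : Z ω = j + 1) => hij ?_
    omega
  have hB_union : ⋃ n, B n = univ := by
    refine eq_univ_of_forall fun ω => mem_iUnion.2 ⟨Z ω - 1, ?_⟩
    have := hZpos ω
    change Z ω = Z ω - 1 + 1
    omega
  have ha_adapted : ∀ i k, i ≤ k → Measurable[ℱ k] (fun ω => ENNReal.ofReal (a i ω)) :=
    fun i k hik => ENNReal.measurable_ofReal.comp
      ((stronglyMeasurable_condExp.mono (ℱ.mono hik)).measurable)
  have ha_meas : ∀ n, Measurable (fun ω => ENNReal.ofReal (a n ω)) :=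
    fun n => (ha_adapted n n le_rfl).mono (ℱ.le n) le_rfl
  have hV : Measurable V := Measurable.tsum ha_meas
  have hmean : ∫⁻ ω, V ω ∂μ = 1 := by
    rw [hVdef, lintegral_tsum fun n => (ha_meas n).aemeasurable]
    have : ∀ n, ∫⁻ ω, ENNReal.ofReal (a n ω) ∂μ = μ (B n) := by
      intro n
      simpa using setLIntegral_ofReal_condExp_indicator_one μ (ℱ.le n)
        (MeasurableSet.univ (m := ℱ n)) (hB n)
    rw [tsum_congr this, ← measure_iUnion hBdisj hB, hB_union, measure_univ]
  have htail : ∀ l : ℝ≥0∞, l ≠ ∞ → ∫⁻ ω, (V ω - l) ∂μ ≤ μ {ω | l < V ω} := by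
    intro l _
    set A : ℕ → Set Ω :=
      fun k => {ω | l < ∑ i ∈ Finset.range (k + 1), ENNReal.ofReal (a i ω)} with hAdef
    have hA : ∀ k, MeasurableSet[ℱ k] (A k) := fun k =>
      measurableSet_lt measurable_const (Finset.measurable_fun_sum _ fun i hi =>
        ha_adapted i k (Nat.lt_succ_iff.1 (Finset.mem_range.1 hi)))
    have hA' : ∀ k, MeasurableSet (A k) := fun k => ℱ.le k _ (hA k)
    calc ∫⁻ ω, (V ω - l) ∂μ
        ≤ ∫⁻ ω, ∑' k, (A k).indicator (fun ω => ENNReal.ofReal (a k ω)) ω ∂μ :=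
          lintegral_mono fun ω => tsub_le_iff_left.2 (by
            classical
            simp only [hVdef, hAdef, indicator_apply, mem_ofPred_eq]
            convert ENNReal.tsum_le_add_tsum_ite_lt_sum_range
              (fun k => ENNReal.ofReal (a k ω)) l)
      _ = ∑' k, μ (B k ∩ A k) := by
          rw [lintegral_tsum fun k => ((ha_meas k).indicator (hA' k)).aemeasurable]
          refine tsum_congr fun k => ?_
          rw [lintegral_indicator (hA' k)]
          exact setLIntegral_ofReal_condExp_indicator_one μ (ℱ.le k) (hA k) (hB k)
      _ = μ (⋃ k, B k ∩ A k) :=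
          (measure_iUnion (fun i j hij => (hBdisj hij).mono inter_subset_left inter_subset_left)
            fun k => (hB k).inter (hA' k)).symm
      _ ≤ μ {ω | l < V ω} :=
          measure_mono (iUnion_subset fun k ω hω =>
            lt_of_lt_of_le hω.2 (ENNReal.sum_le_tsum _))
  have hYV : ∀ᵐ ω ∂μ, ENNReal.ofReal (Y ω) = V ω := by
    have hnonneg : ∀ᵐ ω ∂μ, ∀ n, 0 ≤ a n ω := ae_all_iff.2 fun n =>
      condExp_nonneg (Eventually.of_forall fun ω => indicator_nonneg (fun _ _ => zero_le_one) ω)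
    filter_upwards [hnonneg, ae_lt_top hV (by simp [hmean])] with ω hω hfin
    have hsum : Summable fun n => a n ω := by
      refine (ENNReal.summable_toReal hfin.ne).congr fun n => ?_
      exact ENNReal.toReal_ofReal (hω n)
    rw [hY]
    exact ENNReal.ofReal_tsum_of_nonneg hω hsum
  refine ⟨(lintegral_congr_ae hYV).trans hmean, fun l hl => ?_⟩
  refine le_trans (lintegral_congr_ae ?_).le (lintegral_tsub_le_exp_neg μ hV hmean.le htail hl)
  filter_upwards [hYV] with ω hω
  rw [← hω, ← ENNReal.ofReal_sub _ hl.le, ENNReal.ofReal_max, ENNReal.ofReal_zero,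
    max_eq_left zero_le]
end

section
/- Let (F_n)_{n≥0} be a filtration on a probability space (Ω, F, P), and let (A_n)_{n≥0} be an adapted process with A_0 = 0, with A_n nondecreasing in n, 0 ≤ A_n ≤ 1 for all n, and A_n → 1 almost surely as n → ∞. Define the compensator increments and set R = Σ_{n=1}^∞ E[A_n − A_{n−1} | F_{n−1}]. Then R is dominated in the convex order by a mean-one exponential random variable: for every convex function φ : ℝ → ℝ, E[φ(R)] ≤ ∫_0^∞ φ(x) e^{-x} dx. -/
open MeasureTheory Filter Set
open scoped ENNReal

theorem ConvexOn.exists_affine_minorant_touching {φ : ℝ → ℝ} (hφ : ConvexOn ℝ univ φ) (t : ℝ) :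
    ∃ c : ℝ, ∀ y, φ t + c * (y - t) ≤ φ y := by
  have ht : t ∈ interior (univ : Set ℝ) := by simp
  refine ⟨derivWithin φ (Ioi t) t, fun y => ?_⟩
  rcases lt_trichotomy t y with h | rfl | h
  · have h1 := hφ.rightDeriv_le_slope_of_mem_interior ht (mem_univ y) h
    rw [slope_def_field, le_div_iff₀ (sub_pos.2 h)] at h1
    linarith
  · simp
  · have h1 := hφ.slope_le_leftDeriv_of_mem_interior (mem_univ y) ht h
    have h2 := h1.trans (hφ.leftDeriv_le_rightDeriv_of_mem_interior ht)
    rw [slope_def_field, div_le_iff₀ (sub_pos.2 h)] at h2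
    linarith

theorem ConvexOn.continuous_of_univ {φ : ℝ → ℝ} (hφ : ConvexOn ℝ univ φ) : Continuous φ :=
  continuousOn_univ.1 (hφ.continuousOn isOpen_univ)

theorem integrableOn_sub_mul_exp_neg_Ioi (a : ℝ) :
    IntegrableOn (fun x : ℝ => (x - a) * Real.exp (-x)) (Ioi 0) := by
  have h1 := Real.GammaIntegral_convergent (s := 2) (by norm_num)
  have h2 := (integrableOn_exp_neg_Ioi 0).const_mul a
  refine (h1.sub h2).congr_fun (fun x _ => ?_) measurableSet_Ioi
  norm_num
  ring

theorem integral_sub_mul_exp_neg_Ioi (a : ℝ) {s : ℝ} (hs : 0 ≤ s) :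
    ∫ x in Ioi s, (x - a) * Real.exp (-x) = (s - a + 1) * Real.exp (-s) := by
  have hlim : Tendsto (fun x : ℝ => -((x - a + 1) * Real.exp (-x))) atTop (nhds 0) := by
    have h1 := Real.tendsto_pow_mul_exp_neg_atTop_nhds_zero 1
    have h0 := (Real.tendsto_pow_mul_exp_neg_atTop_nhds_zero 0).const_mul (1 - a)
    have := (h1.add h0).neg
    simp only [mul_zero, add_zero, neg_zero] at this
    refine this.congr fun x => ?_
    ring
  rw [integral_Ioi_of_hasDerivAt_of_tendsto' (f := fun x : ℝ => -((x - a + 1) * Real.exp (-x)))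
    (fun x _ => ?_) ((integrableOn_sub_mul_exp_neg_Ioi a).mono_set (Ioi_subset_Ioi hs)) hlim]
  · ring
  · have h := ((((hasDerivAt_id x).sub_const a).add_const 1).mul
      ((hasDerivAt_id x).neg.exp)).neg
    refine h.congr_deriv ?_
    simp only [id, Pi.neg_apply]
    ring

/-- The expectation of `φ (r + q E)` for a mean-one exponential variable `E`. -/
noncomputable def expMean (φ : ℝ → ℝ) (r q : ℝ) : ℝ≥0∞ :=
  ∫⁻ x in Ioi (0 : ℝ), ENNReal.ofReal (φ (r + q * x) * Real.exp (-x))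

theorem lintegral_exp_neg_Ioi_zero :
    ∫⁻ x in Ioi (0 : ℝ), ENNReal.ofReal (Real.exp (-x)) = 1 := by
  rw [← ofReal_integral_eq_lintegral_ofReal (integrableOn_exp_neg_Ioi 0)
    (ae_of_all _ fun x => (Real.exp_pos _).le), integral_exp_neg_Ioi_zero, ENNReal.ofReal_one]

theorem measurable_expMean {φ : ℝ → ℝ} (hφ : Measurable φ) :
    Measurable fun p : ℝ × ℝ => expMean φ p.1 p.2 := by
  refine Measurable.lintegral_prod_right'
    (f := fun z : (ℝ × ℝ) × ℝ =>
      ENNReal.ofReal (φ (z.1.1 + z.1.2 * z.2) * Real.exp (-z.2))) ?_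
  fun_prop

theorem expMean_le_of_shrink {φ : ℝ → ℝ} (hφ : ConvexOn ℝ univ φ) (h0 : ∀ x, 0 ≤ φ x)
    (r q : ℝ) {t : ℝ} (ht0 : 0 ≤ t) (ht1 : t ≤ 1) :
    expMean φ r (q * (1 - t)) ≤
      ENNReal.ofReal (1 - t) * expMean φ r q + ENNReal.ofReal t * ENNReal.ofReal (φ r) := by
  have hc := hφ.continuous_of_univ
  calc expMean φ r (q * (1 - t))
      ≤ ∫⁻ x in Ioi (0 : ℝ), (ENNReal.ofReal (1 - t) *
            ENNReal.ofReal (φ (r + q * x) * Real.exp (-x)) +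
          ENNReal.ofReal t * ENNReal.ofReal (φ r) * ENNReal.ofReal (Real.exp (-x))) := by
        refine lintegral_mono fun x => ?_
        rw [← ENNReal.ofReal_mul (by linarith), ← ENNReal.ofReal_mul ht0,
          ← ENNReal.ofReal_mul (mul_nonneg ht0 (h0 _)),
          ← ENNReal.ofReal_add (mul_nonneg (by linarith) (mul_nonneg (h0 _) (Real.exp_pos _).le))
            (mul_nonneg (mul_nonneg ht0 (h0 _)) (Real.exp_pos _).le)]
        refine ENNReal.ofReal_le_ofReal ?_
        have h := hφ.2 (mem_univ (r + q * x)) (mem_univ r) (sub_nonneg.2 ht1) ht0 (by ring)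
        simp only [smul_eq_mul] at h
        have e : (1 - t) * (r + q * x) + t * r = r + q * (1 - t) * x := by ring
        rw [e] at h
        nlinarith [mul_le_mul_of_nonneg_right h (Real.exp_pos (-x)).le]
    _ = _ := by
        rw [lintegral_add_left (by fun_prop), lintegral_const_mul _ (by fun_prop),
          lintegral_const_mul _ (by fun_prop), lintegral_exp_neg_Ioi_zero, mul_one]
        rfl

theorem integral_mul_exp_neg_shift_le {ψ : ℝ → ℝ} (hψ : ConvexOn ℝ univ ψ)
    (hint : IntegrableOn (fun x => ψ x * Real.exp (-x)) (Ioi 0))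
    {s : ℝ} (hs0 : 0 ≤ s) :
    (1 - s) * (Real.exp s * ∫ x in Ioi s, ψ x * Real.exp (-x)) + s * ψ s ≤
      ∫ x in Ioi (0 : ℝ), ψ x * Real.exp (-x) := by
  obtain ⟨c, hc⟩ := hψ.exists_affine_minorant_touching s
  set g : ℝ → ℝ := fun x => ψ x * Real.exp (-x) - ψ s * Real.exp (-x) -
    c * ((x - s) * Real.exp (-x)) with hg
  have hg0 : ∀ x, 0 ≤ g x := fun x => by
    have := mul_nonneg (sub_nonneg.2 (hc x)) (Real.exp_pos (-x)).le
    simp only [hg]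
    linarith
  have he := (integrableOn_exp_neg_Ioi 0).const_mul (ψ s)
  have hl := (integrableOn_sub_mul_exp_neg_Ioi s).const_mul c
  have hgi : IntegrableOn g (Ioi 0) := (hint.sub he).sub hl
  have key : ∀ u, 0 ≤ u → ∫ x in Ioi u, g x = (∫ x in Ioi u, ψ x * Real.exp (-x)) -
      ψ s * Real.exp (-u) - c * ((u - s + 1) * Real.exp (-u)) := fun u hu => by
    have hm : volume.restrict (Ioi u) ≤ volume.restrict (Ioi (0 : ℝ)) :=
      Measure.restrict_mono_set _ (Ioi_subset_Ioi hu)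
    simp only [hg]
    rw [integral_sub, integral_sub, integral_const_mul, integral_const_mul,
      integral_exp_neg_Ioi, integral_sub_mul_exp_neg_Ioi s hu]
    exacts [Integrable.mono_measure hint hm, Integrable.mono_measure he hm,
      Integrable.mono_measure (hint.sub he) hm, Integrable.mono_measure hl hm]
  have hle : ∫ x in Ioi s, g x ≤ ∫ x in Ioi (0 : ℝ), g x :=
    setIntegral_mono_set hgi (ae_of_all _ hg0) (Ioi_subset_Ioi hs0).eventuallyLE
  have hpos : 0 ≤ ∫ x in Ioi s, g x := integral_nonneg hg0
  have hes : (1 - s) * Real.exp s ≤ 1 := by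
    have h1 := Real.add_one_le_exp (-s)
    have h2 : Real.exp (-s) * Real.exp s = 1 := by rw [← Real.exp_add]; simp
    nlinarith [mul_le_mul_of_nonneg_right h1 (Real.exp_pos s).le]
  have hmul := mul_le_mul_of_nonneg_right hes hpos
  have k0 := key 0 le_rfl
  have ks := key s hs0
  simp only [neg_zero, Real.exp_zero, mul_one, sub_self, zero_add, one_mul] at k0 ks
  have hexp : Real.exp s * Real.exp (-s) = 1 := by rw [← Real.exp_add]; simp
  have e : ∫ x in Ioi s, ψ x * Real.exp (-x) =
      (∫ x in Ioi s, g x) + (ψ s + c) * Real.exp (-s) := by rw [ks]; ring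
  have e2 : Real.exp s * ∫ x in Ioi s, ψ x * Real.exp (-x) =
      Real.exp s * (∫ x in Ioi s, g x) + (ψ s + c) := by
    rw [e]; linear_combination (ψ s + c) * hexp
  rw [e2]
  nlinarith

theorem expMean_shift_le {φ : ℝ → ℝ} (hφ : ConvexOn ℝ univ φ) (h0 : ∀ x, 0 ≤ φ x)
    (r q : ℝ) {s : ℝ} (hs0 : 0 ≤ s) (hs1 : s ≤ 1) :
    ENNReal.ofReal (1 - s) * expMean φ (r + q * s) q +
      ENNReal.ofReal s * ENNReal.ofReal (φ (r + q * s)) ≤ expMean φ r q := by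
  by_cases htop : expMean φ r q = ∞
  · simp [htop]
  have hcont := hφ.continuous_of_univ
  set ψ : ℝ → ℝ := fun x => φ (r + q * x) with hψdef
  have hψ : ConvexOn ℝ univ ψ := by
    refine ⟨convex_univ, fun x _ y _ a b ha hb hab => ?_⟩
    have h := hφ.2 (mem_univ (r + q * x)) (mem_univ (r + q * y)) ha hb hab
    have e : a • (r + q * x) + b • (r + q * y) = r + q * (a • x + b • y) := by
      simp only [smul_eq_mul]
      linear_combination r * hab
    rwa [e] at h
  have hψc : Continuous ψ := hψ.continuous_of_univ
  have hnn : ∀ x, 0 ≤ ψ x * Real.exp (-x) := fun x => mul_nonneg (h0 _) (Real.exp_pos _).le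
  have hint : IntegrableOn (fun x => ψ x * Real.exp (-x)) (Ioi 0) :=
    (lintegral_ofReal_ne_top_iff_integrable (by fun_prop) (ae_of_all _ hnn)).1 htop
  have hints := hint.mono_set (Ioi_subset_Ioi hs0)
  have hshift : expMean φ (r + q * s) q =
      ENNReal.ofReal (Real.exp s * ∫ x in Ioi s, ψ x * Real.exp (-x)) := by
    rw [ENNReal.ofReal_mul (Real.exp_pos _).le,
      ofReal_integral_eq_lintegral_ofReal hints (ae_of_all _ hnn),
      ← lintegral_const_mul _ (by fun_prop)]
    have hpre : (fun x : ℝ => x + s) ⁻¹' Ioi s = Ioi 0 := by ext x; simp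
    rw [← (measurePreserving_add_right volume s).setLIntegral_comp_preimage measurableSet_Ioi
      (by fun_prop), hpre]
    refine lintegral_congr fun x => ?_
    rw [← ENNReal.ofReal_mul (Real.exp_pos _).le]
    congr 1
    have e : Real.exp s * Real.exp (-(x + s)) = Real.exp (-x) := by
      rw [← Real.exp_add]; congr 1; ring
    simp only [hψdef]
    rw [← e]
    ring_nf
  have hK : expMean φ r q = ENNReal.ofReal (∫ x in Ioi (0 : ℝ), ψ x * Real.exp (-x)) :=
    (ofReal_integral_eq_lintegral_ofReal hint (ae_of_all _ hnn)).symm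
  rw [hshift, hK, ← ENNReal.ofReal_mul (by linarith), ← ENNReal.ofReal_mul hs0,
    ← ENNReal.ofReal_add (mul_nonneg (by linarith) (mul_nonneg (Real.exp_pos _).le
      (integral_nonneg hnn))) (mul_nonneg hs0 (h0 _))]
  exact ENNReal.ofReal_le_ofReal (integral_mul_exp_neg_shift_le hψ hint hs0)

theorem ofReal_le_expMean {φ : ℝ → ℝ} (hφ : ConvexOn ℝ univ φ) (h0 : ∀ x, 0 ≤ φ x) (r q : ℝ) :
    ENNReal.ofReal (φ (r + q)) ≤ expMean φ r q := by
  simpa using expMean_shift_le hφ h0 r q zero_le_one le_rfl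

theorem lintegral_ofReal_condExp_mul {Ω : Type*} {m m0 : MeasurableSpace Ω} {μ : Measure Ω}
    [IsFiniteMeasure μ] (hm : m ≤ m0) {f : Ω → ℝ} (hf : Integrable f μ) (hf0 : 0 ≤ᵐ[μ] f)
    {W : Ω → ℝ≥0∞} (hW : Measurable[m] W) :
    ∫⁻ ω, ENNReal.ofReal (f ω) * W ω ∂μ = ∫⁻ ω, ENNReal.ofReal (μ[f | m] ω) * W ω ∂μ := by
  have hfm : AEMeasurable (fun ω => ENNReal.ofReal (f ω)) μ := hf.aemeasurable.ennreal_ofReal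
  have hcm : AEMeasurable (fun ω => ENNReal.ofReal (μ[f | m] ω)) μ :=
    integrable_condExp.aemeasurable.ennreal_ofReal
  have htrim : (μ.withDensity fun ω => ENNReal.ofReal (f ω)).trim hm =
      (μ.withDensity fun ω => ENNReal.ofReal (μ[f | m] ω)).trim hm := by
    refine @Measure.ext _ m _ _ fun s hs => ?_
    rw [trim_measurableSet_eq hm hs, trim_measurableSet_eq hm hs, withDensity_apply _ (hm s hs),
      withDensity_apply _ (hm s hs),
      ← ofReal_integral_eq_lintegral_ofReal hf.integrableOn (ae_restrict_of_ae hf0),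
      ← ofReal_integral_eq_lintegral_ofReal integrable_condExp.integrableOn
        (ae_restrict_of_ae (condExp_nonneg hf0)), setIntegral_condExp hm hf hs]
  have h1 := lintegral_trim (μ := μ.withDensity fun ω => ENNReal.ofReal (f ω)) hm hW
  have h2 := lintegral_trim (μ := μ.withDensity fun ω => ENNReal.ofReal (μ[f | m] ω)) hm hW
  rw [htrim, h2] at h1
  have hW' : AEMeasurable W μ := (hW.mono hm le_rfl).aemeasurable
  rw [lintegral_withDensity_eq_lintegral_mul₀ hcm hW',
    lintegral_withDensity_eq_lintegral_mul₀ hfm hW'] at h1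
  exact h1.symm

theorem lintegral_expMean_step {Ω : Type*} {m m0 : MeasurableSpace Ω} {μ : Measure Ω}
    [IsFiniteMeasure μ] (hm : m ≤ m0) {φ : ℝ → ℝ} (hφ : ConvexOn ℝ univ φ) (h0 : ∀ x, 0 ≤ φ x)
    {r q d : Ω → ℝ} (hr : Measurable[m] r) (hq : Measurable[m] q) (hd : Integrable d μ)
    (hd0 : ∀ ω, 0 ≤ d ω) (hdq : ∀ ω, d ω ≤ q ω) (hqi : Integrable q μ) :
    ∫⁻ ω, expMean φ (r ω + μ[d | m] ω) (q ω - d ω) ∂μ ≤ ∫⁻ ω, expMean φ (r ω) (q ω) ∂μ := by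
  have hφm : Measurable φ := hφ.continuous_of_univ.measurable
  set δ : Ω → ℝ := μ[d | m] with hδ
  have hδm : Measurable[m] δ := stronglyMeasurable_condExp.measurable
  have hq0 : ∀ ω, 0 ≤ q ω := fun ω => (hd0 ω).trans (hdq ω)
  set t : Ω → ℝ := fun ω => (q ω)⁻¹ * d ω with ht
  have ht0 : ∀ ω, 0 ≤ t ω := fun ω => mul_nonneg (inv_nonneg.2 (hq0 ω)) (hd0 ω)
  have ht1 : ∀ ω, t ω ≤ 1 := fun ω => by
    simp only [ht]
    rw [inv_mul_eq_div]
    exact div_le_one_of_le₀ (hdq ω) (hq0 ω)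
  have hqt : ∀ ω, q ω - d ω = q ω * (1 - t ω) := fun ω => by
    by_cases h : q ω = 0
    · have : d ω = 0 := le_antisymm (h ▸ hdq ω) (hd0 ω)
      simp [h, this]
    · simp only [ht]
      field_simp
  have htae : AEStronglyMeasurable t μ :=
    ((hq.mono hm le_rfl).inv.aestronglyMeasurable).mul hd.aestronglyMeasurable
  have hti : Integrable t μ := by
    refine (integrable_const (1 : ℝ)).mono' htae (ae_of_all _ fun ω => ?_)
    rw [Real.norm_of_nonneg (ht0 ω)]
    exact ht1 ω
  have hut : Integrable (fun ω => 1 - t ω) μ := (integrable_const 1).sub hti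
  have hs : μ[t | m] =ᵐ[μ] fun ω => (q ω)⁻¹ * δ ω :=
    condExp_mul_of_stronglyMeasurable_left hq.inv.stronglyMeasurable hti hd
  have hs' : μ[fun ω => 1 - t ω | m] =ᵐ[μ] fun ω => 1 - (q ω)⁻¹ * δ ω := by
    have h := condExp_sub (integrable_const (1 : ℝ)) hti m (μ := μ)
    rw [condExp_const hm] at h
    filter_upwards [h, hs] with ω h1 h2
    exact h1.trans (by simp [h2])
  have hδ0 : ∀ᵐ ω ∂μ, 0 ≤ δ ω := condExp_nonneg (ae_of_all _ hd0)
  have hδq : ∀ᵐ ω ∂μ, δ ω ≤ q ω := by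
    have h := condExp_mono (m := m) hd hqi (ae_of_all _ hdq)
    rwa [condExp_of_stronglyMeasurable hm hq.stronglyMeasurable hqi] at h
  have hVm : Measurable[m] fun ω => expMean φ (r ω + δ ω) (q ω) :=
    (measurable_expMean hφm).comp ((hr.add hδm).prodMk hq)
  have hFm : Measurable[m] fun ω => ENNReal.ofReal (φ (r ω + δ ω)) :=
    (hφm.comp (hr.add hδm)).ennreal_ofReal
  have hu1 : AEMeasurable
      (fun ω => ENNReal.ofReal (1 - t ω) * expMean φ (r ω + δ ω) (q ω)) μ :=
    hut.aemeasurable.ennreal_ofReal.mul (hVm.mono hm le_rfl).aemeasurable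
  have hu2 : AEMeasurable (fun ω =>
      ENNReal.ofReal (μ[fun ω => 1 - t ω | m] ω) * expMean φ (r ω + δ ω) (q ω)) μ :=
    integrable_condExp.aemeasurable.ennreal_ofReal.mul (hVm.mono hm le_rfl).aemeasurable
  calc ∫⁻ ω, expMean φ (r ω + δ ω) (q ω - d ω) ∂μ
      ≤ ∫⁻ ω, (ENNReal.ofReal (1 - t ω) * expMean φ (r ω + δ ω) (q ω) +
          ENNReal.ofReal (t ω) * ENNReal.ofReal (φ (r ω + δ ω))) ∂μ := by
        refine lintegral_mono fun ω => ?_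
        simp only [hqt ω]
        exact expMean_le_of_shrink hφ h0 _ _ (ht0 ω) (ht1 ω)
    _ = ∫⁻ ω, (ENNReal.ofReal (1 - (q ω)⁻¹ * δ ω) * expMean φ (r ω + δ ω) (q ω) +
          ENNReal.ofReal ((q ω)⁻¹ * δ ω) * ENNReal.ofReal (φ (r ω + δ ω))) ∂μ := by
        rw [lintegral_add_left' hu1,
          lintegral_ofReal_condExp_mul hm hut (ae_of_all _ fun ω => sub_nonneg.2 (ht1 ω)) hVm,
          lintegral_ofReal_condExp_mul hm hti (ae_of_all _ ht0) hFm,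
          ← lintegral_add_left' hu2]
        refine lintegral_congr_ae ?_
        filter_upwards [hs, hs'] with ω h1 h2
        rw [h1, h2]
    _ ≤ ∫⁻ ω, expMean φ (r ω) (q ω) ∂μ := by
        refine lintegral_mono_ae ?_
        filter_upwards [hδ0, hδq] with ω h1 h2
        have e : q ω * ((q ω)⁻¹ * δ ω) = δ ω := by
          by_cases h : q ω = 0
          · simp [h, le_antisymm (h ▸ h2) h1]
          · field_simp
        have hle : (q ω)⁻¹ * δ ω ≤ 1 := by
          rw [inv_mul_eq_div]
          exact div_le_one_of_le₀ h2 (hq0 ω)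
        have := expMean_shift_le hφ h0 (r ω) (q ω) (mul_nonneg (inv_nonneg.2 (hq0 ω)) h1) hle
        rwa [e] at this

theorem measurable_compensator {Ω : Type*} {m : MeasurableSpace Ω} {μ : Measure Ω}
    {ℱ : Filtration ℕ m} {A : ℕ → Ω → ℝ} (n k : ℕ) (hk : k ≤ n + 1) :
    Measurable[ℱ n] fun ω => ∑ i ∈ Finset.range k, μ[A (i + 1) - A i | ℱ i] ω := by
  refine Finset.measurable_fun_sum _ fun i hi => ?_
  have hin : i ≤ n := by have := Finset.mem_range.1 hi; omega
  exact (stronglyMeasurable_condExp.mono (ℱ.mono hin)).measurable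

section Compensator

variable {Ω : Type*} {m : MeasurableSpace Ω} {μ : Measure Ω} [IsProbabilityMeasure μ]
  {ℱ : Filtration ℕ m} {A : ℕ → Ω → ℝ}

theorem integrable_of_adapted_of_mem_unitInterval (hA : Adapted ℱ A)
    (hbdd : ∀ n ω, 0 ≤ A n ω ∧ A n ω ≤ 1) (n : ℕ) : Integrable (A n) μ := by
  refine (integrable_const (1 : ℝ)).mono'
    ((hA n).mono (ℱ.le n) le_rfl).aestronglyMeasurable (ae_of_all _ fun ω => ?_)
  rw [Real.norm_of_nonneg (hbdd n ω).1]
  exact (hbdd n ω).2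

theorem lintegral_expMean_compensator_le (hA : Adapted ℱ A) (hA0 : ∀ ω, A 0 ω = 0)
    (hmono : ∀ ω, Monotone fun n => A n ω) (hbdd : ∀ n ω, 0 ≤ A n ω ∧ A n ω ≤ 1)
    {φ : ℝ → ℝ} (hφ : ConvexOn ℝ univ φ) (h0 : ∀ x, 0 ≤ φ x) (n : ℕ) :
    ∫⁻ ω, expMean φ (∑ i ∈ Finset.range n, μ[A (i + 1) - A i | ℱ i] ω) (1 - A n ω) ∂μ ≤
      expMean φ 0 1 := by
  induction n with
  | zero => simp [hA0]
  | succ n ih =>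
    refine le_trans (le_of_eq ?_) ((lintegral_expMean_step (μ := μ) (ℱ.le n) hφ h0
      (measurable_compensator n n n.le_succ) ((hA n).const_sub 1)
      ((integrable_of_adapted_of_mem_unitInterval hA hbdd (n + 1)).sub
        (integrable_of_adapted_of_mem_unitInterval hA hbdd n))
      (fun ω => sub_nonneg.2 (hmono ω n.le_succ))
      (fun ω => sub_le_sub_right (hbdd (n + 1) ω).2 _)
      ((integrable_const 1).sub (integrable_of_adapted_of_mem_unitInterval hA hbdd n))).trans ih)
    refine lintegral_congr fun ω => ?_
    rw [Finset.sum_range_succ]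
    simp

theorem summable_compensator_and_integral (hA : Adapted ℱ A) (hA0 : ∀ ω, A 0 ω = 0)
    (hmono : ∀ ω, Monotone fun n => A n ω) (hbdd : ∀ n ω, 0 ≤ A n ω ∧ A n ω ≤ 1)
    (hlim : ∀ᵐ ω ∂μ, Tendsto (fun n => A n ω) atTop (nhds 1)) :
    (∀ᵐ ω ∂μ, Summable fun n => μ[A (n + 1) - A n | ℱ n] ω) ∧
      Integrable (fun ω => ∑' n, μ[A (n + 1) - A n | ℱ n] ω) μ ∧
      ∫ ω, ∑' n, μ[A (n + 1) - A n | ℱ n] ω ∂μ = 1 := by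
  have hAi := integrable_of_adapted_of_mem_unitInterval (μ := μ) hA hbdd
  have hnn : ∀ᵐ ω ∂μ, ∀ n, 0 ≤ μ[A (n + 1) - A n | ℱ n] ω := ae_all_iff.2 fun n =>
    condExp_nonneg (ae_of_all _ fun ω => sub_nonneg.2 (hmono ω n.le_succ))
  have hint : ∀ n, ∫ ω, μ[A (n + 1) - A n | ℱ n] ω ∂μ = ∫ ω, A (n + 1) ω ∂μ - ∫ ω, A n ω ∂μ :=
    fun n => by
      rw [integral_condExp (ℱ.le n)]
      exact integral_sub (hAi (n + 1)) (hAi n)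
  have hint0 : ∀ n, 0 ≤ ∫ ω, μ[A (n + 1) - A n | ℱ n] ω ∂μ := fun n =>
    integral_nonneg_of_ae (hnn.mono fun ω h => h n)
  have hlimE : Tendsto (fun n => ∫ ω, A n ω ∂μ) atTop (nhds 1) := by
    have := tendsto_integral_of_dominated_convergence (μ := μ) (F := A) (f := fun _ => (1 : ℝ))
      (fun _ => 1) (fun n => (hAi n).aestronglyMeasurable) (integrable_const 1)
      (fun n => ae_of_all _ fun ω => by
        rw [Real.norm_of_nonneg (hbdd n ω).1]; exact (hbdd n ω).2) hlim
    simpa using this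
  have hsum : HasSum (fun n => ∫ ω, μ[A (n + 1) - A n | ℱ n] ω ∂μ) 1 := by
    rw [hasSum_iff_tendsto_nat_of_nonneg hint0]
    refine hlimE.congr fun n => ?_
    simp only [hint]
    rw [Finset.sum_range_sub fun n => ∫ ω, A n ω ∂μ]
    simp [hA0]
  have hlint : ∫⁻ ω, ∑' n, ENNReal.ofReal (μ[A (n + 1) - A n | ℱ n] ω) ∂μ = 1 := by
    rw [lintegral_tsum fun n => integrable_condExp.aemeasurable.ennreal_ofReal]
    simp_rw [← ofReal_integral_eq_lintegral_ofReal integrable_condExp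
      (hnn.mono fun ω h => h _)]
    rw [← ENNReal.ofReal_tsum_of_nonneg hint0 hsum.summable, hsum.tsum_eq, ENNReal.ofReal_one]
  have hmeas : AEMeasurable (fun ω => ∑' n, ENNReal.ofReal (μ[A (n + 1) - A n | ℱ n] ω)) μ :=
    AEMeasurable.tsum fun n => integrable_condExp.aemeasurable.ennreal_ofReal
  have hsummable : ∀ᵐ ω ∂μ, Summable fun n => μ[A (n + 1) - A n | ℱ n] ω := by
    filter_upwards [ae_lt_top' hmeas (by simp [hlint]), hnn] with ω h1 h2
    refine (ENNReal.summable_toReal h1.ne).congr fun n => ?_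
    rw [ENNReal.toReal_ofReal (h2 n)]
  have hR : (fun ω => ∑' n, μ[A (n + 1) - A n | ℱ n] ω) =ᵐ[μ]
      fun ω => (∑' n, ENNReal.ofReal (μ[A (n + 1) - A n | ℱ n] ω)).toReal := by
    filter_upwards [hsummable, hnn] with ω h1 h2
    rw [← ENNReal.ofReal_tsum_of_nonneg h2 h1, ENNReal.toReal_ofReal (tsum_nonneg h2)]
  refine ⟨hsummable, (integrable_toReal_of_lintegral_ne_top hmeas (by simp [hlint])).congr hR.symm,
    ?_⟩
  rw [integral_congr_ae hR, integral_toReal hmeas (ae_lt_top' hmeas (by simp [hlint])), hlint,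
    ENNReal.toReal_one]

theorem lintegral_compensator_le_expMean (hA : Adapted ℱ A) (hA0 : ∀ ω, A 0 ω = 0)
    (hmono : ∀ ω, Monotone fun n => A n ω) (hbdd : ∀ n ω, 0 ≤ A n ω ∧ A n ω ≤ 1)
    (hlim : ∀ᵐ ω ∂μ, Tendsto (fun n => A n ω) atTop (nhds 1))
    {φ : ℝ → ℝ} (hφ : ConvexOn ℝ univ φ) (h0 : ∀ x, 0 ≤ φ x) :
    ∫⁻ ω, ENNReal.ofReal (φ (∑' n, μ[A (n + 1) - A n | ℱ n] ω)) ∂μ ≤ expMean φ 0 1 := by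
  have hcont := hφ.continuous_of_univ
  set S : ℕ → Ω → ℝ := fun n ω =>
    ∑ i ∈ Finset.range n, μ[A (i + 1) - A i | ℱ i] ω + (1 - A n ω) with hS
  have hSm : ∀ n, Measurable (S n) := fun n =>
    ((measurable_compensator n n n.le_succ).mono (ℱ.le n) le_rfl).add
      (((hA n).mono (ℱ.le n) le_rfl).const_sub 1)
  calc ∫⁻ ω, ENNReal.ofReal (φ (∑' n, μ[A (n + 1) - A n | ℱ n] ω)) ∂μ
      = ∫⁻ ω, liminf (fun n => ENNReal.ofReal (φ (S n ω))) atTop ∂μ := by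
        refine lintegral_congr_ae ?_
        filter_upwards [hlim, (summable_compensator_and_integral hA hA0 hmono hbdd hlim).1]
          with ω h1 h2
        have h3 : Tendsto (fun n => S n ω) atTop
            (nhds (∑' n, μ[A (n + 1) - A n | ℱ n] ω)) := by
          simpa using h2.hasSum.tendsto_sum_nat.add (h1.const_sub 1)
        exact (ENNReal.tendsto_ofReal ((hcont.tendsto _).comp h3)).liminf_eq.symm
    _ ≤ liminf (fun n => ∫⁻ ω, ENNReal.ofReal (φ (S n ω)) ∂μ) atTop :=
        lintegral_liminf_le fun n => (hcont.measurable.comp (hSm n)).ennreal_ofReal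
    _ ≤ expMean φ 0 1 := by
        refine liminf_le_of_le (by isBoundedDefault) fun b hb => ?_
        obtain ⟨n, hn⟩ := hb.exists
        exact hn.trans ((lintegral_mono fun ω => ofReal_le_expMean hφ h0 _ _).trans
          (lintegral_expMean_compensator_le hA hA0 hmono hbdd hφ h0 n))

end Compensator

theorem lintegral_pos_add_neg_le_of_integral_le {α β : Type*} {mα : MeasurableSpace α}
    {mβ : MeasurableSpace β} {μ : Measure α} {ν : Measure β} {f : α → ℝ} {g : β → ℝ}
    (hf : Integrable f μ) (hg : Integrable g ν) (h : ∫ x, f x ∂μ ≤ ∫ y, g y ∂ν) :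
    (∫⁻ x, ENNReal.ofReal (f x) ∂μ) + ∫⁻ y, ENNReal.ofReal (-g y) ∂ν ≤
      (∫⁻ y, ENNReal.ofReal (g y) ∂ν) + ∫⁻ x, ENNReal.ofReal (-f x) ∂μ := by
  rw [integral_eq_lintegral_pos_part_sub_lintegral_neg_part hf,
    integral_eq_lintegral_pos_part_sub_lintegral_neg_part hg] at h
  have a1 := hf.lintegral_lt_top.ne
  have a2 := hf.neg.lintegral_lt_top.ne
  have b1 := hg.lintegral_lt_top.ne
  have b2 := hg.neg.lintegral_lt_top.ne
  simp only [Pi.neg_apply] at a2 b2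
  rw [← ENNReal.toReal_le_toReal (ENNReal.add_ne_top.2 ⟨a1, b2⟩) (ENNReal.add_ne_top.2 ⟨b1, a2⟩),
    ENNReal.toReal_add a1 b2, ENNReal.toReal_add b1 a2]
  linarith

/-- **Maximum variation of total risk, discrete-time compensator version.**
Let `A` be an adapted nondecreasing process with `A 0 = 0`, `0 ≤ A n ≤ 1`, and
`A n → 1` almost surely.  Let `R = ∑_{n=1}^∞ E[A n − A (n−1) | ℱ (n−1)]` be the total
mass of the compensator of `A`.  Then `R` is dominated in the convex order by a mean-one
exponential random variable: for every convex `φ : ℝ → ℝ`,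
`E[φ(R)] ≤ ∫_0^∞ φ(x) e^{-x} dx`, where both sides may be infinite.  The inequality of
possibly-infinite expectations `E[f] ≤ E[g]` is encoded as
`E[f⁺] + E[g⁻] ≤ E[g⁺] + E[f⁻]` using lower Lebesgue integrals. -/
theorem total_risk_compensator_convex_order
    {Ω : Type*} {m : MeasurableSpace Ω} (μ : Measure Ω) [IsProbabilityMeasure μ]
    (ℱ : Filtration ℕ m) (A : ℕ → Ω → ℝ) (hA : Adapted ℱ A)
    (hA0 : ∀ ω, A 0 ω = 0)
    (hmono : ∀ ω, Monotone fun n => A n ω)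
    (hbdd : ∀ n ω, 0 ≤ A n ω ∧ A n ω ≤ 1)
    (hlim : ∀ᵐ ω ∂μ, Tendsto (fun n => A n ω) atTop (nhds 1))
    (R : Ω → ℝ)
    (hR : R = fun ω => ∑' n : ℕ, (μ[A (n + 1) - A n | ℱ n]) ω) :
    ∀ φ : ℝ → ℝ, ConvexOn ℝ Set.univ φ →
      (∫⁻ ω, ENNReal.ofReal (φ (R ω)) ∂μ)
          + (∫⁻ x in Set.Ioi (0 : ℝ), ENNReal.ofReal (-(φ x * Real.exp (-x))))
        ≤ (∫⁻ x in Set.Ioi (0 : ℝ), ENNReal.ofReal (φ x * Real.exp (-x)))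
          + (∫⁻ ω, ENNReal.ofReal (-(φ (R ω))) ∂μ) := by
  intro φ hφ
  obtain ⟨-, hRi, hR1⟩ := summable_compensator_and_integral hA hA0 hmono hbdd hlim
  rw [← hR] at hRi
  have hR1' : ∫ ω, R ω ∂μ = 1 := by rw [hR]; exact hR1
  obtain ⟨c, hc⟩ := hφ.exists_affine_minorant_touching 1
  set ψ : ℝ → ℝ := fun x => φ x - (φ 1 + c * (x - 1)) with hψdef
  have hψ0 : ∀ x, 0 ≤ ψ x := fun x => sub_nonneg.2 (hc x)
  have hψ : ConvexOn ℝ univ ψ := by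
    refine ⟨convex_univ, fun x hx y hy a b ha hb hab => ?_⟩
    have h := hφ.2 hx hy ha hb hab
    simp only [smul_eq_mul, hψdef] at h ⊢
    linear_combination h + (φ 1 - c) * hab
  have hφm : Measurable φ := hφ.continuous_of_univ.measurable
  have hψm : Measurable ψ := hψ.continuous_of_univ.measurable
  have hlin : IntegrableOn (fun x : ℝ => (φ 1 + c * (x - 1)) * Real.exp (-x)) (Ioi 0) := by
    refine (((integrableOn_exp_neg_Ioi 0).const_mul (φ 1)).add
      ((integrableOn_sub_mul_exp_neg_Ioi 1).const_mul c)).congr (ae_of_all _ fun x => ?_)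
    simp only [Pi.add_apply]
    ring
  have hnn : ∀ x, 0 ≤ ψ x * Real.exp (-x) := fun x => mul_nonneg (hψ0 x) (Real.exp_pos _).le
  have hsplit : ∀ x, φ x * Real.exp (-x) =
      ψ x * Real.exp (-x) + (φ 1 + c * (x - 1)) * Real.exp (-x) := fun x => by
    simp only [hψdef]
    ring
  have hmain : ∫⁻ ω, ENNReal.ofReal (ψ (R ω)) ∂μ ≤
      ∫⁻ x in Ioi (0 : ℝ), ENNReal.ofReal (ψ x * Real.exp (-x)) := by
    have h := lintegral_compensator_le_expMean hA hA0 hmono hbdd hlim hψ hψ0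
    simp only [expMean, zero_add, one_mul] at h
    rwa [hR]
  by_cases htop : ∫⁻ x in Ioi (0 : ℝ), ENNReal.ofReal (φ x * Real.exp (-x)) = ∞
  · rw [htop, top_add]
    exact le_top
  have hψtop : ∫⁻ x in Ioi (0 : ℝ), ENNReal.ofReal (ψ x * Real.exp (-x)) ≠ ∞ := by
    refine ne_top_of_le_ne_top (ENNReal.add_ne_top.2 ⟨htop, hlin.neg.lintegral_lt_top.ne⟩) ?_
    rw [← lintegral_add_left (by fun_prop)]
    refine lintegral_mono fun x => ?_
    refine le_trans (ENNReal.ofReal_le_ofReal (le_of_eq ?_)) ENNReal.ofReal_add_le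
    simp only [Pi.neg_apply]
    linarith [hsplit x]
  have hψi : IntegrableOn (fun x => ψ x * Real.exp (-x)) (Ioi 0) :=
    (lintegral_ofReal_ne_top_iff_integrable (by fun_prop) (ae_of_all _ hnn)).1 hψtop
  have hψR : Integrable (fun ω => ψ (R ω)) μ :=
    (lintegral_ofReal_ne_top_iff_integrable
      (hψm.comp_aemeasurable hRi.aemeasurable).aestronglyMeasurable
      (ae_of_all _ fun ω => hψ0 _)).1 (ne_top_of_le_ne_top hψtop hmain)
  have hlinR : Integrable (fun ω => φ 1 + c * (R ω - 1)) μ :=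
    (integrable_const _).add ((hRi.sub (integrable_const 1)).const_mul c)
  have hle : ∫ ω, ψ (R ω) ∂μ ≤ ∫ x in Ioi (0 : ℝ), ψ x * Real.exp (-x) := by
    rw [← ofReal_integral_eq_lintegral_ofReal hψR (ae_of_all _ fun ω => hψ0 _),
      ← ofReal_integral_eq_lintegral_ofReal hψi (ae_of_all _ hnn)] at hmain
    exact (ENNReal.ofReal_le_ofReal_iff (integral_nonneg hnn)).1 hmain
  have hφR : (fun ω => φ (R ω)) = fun ω => ψ (R ω) + (φ 1 + c * (R ω - 1)) := by
    ext ω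
    simp [hψdef]
  have hφE : (fun x => φ x * Real.exp (-x)) = fun x =>
      ψ x * Real.exp (-x) + (φ 1 + c * (x - 1)) * Real.exp (-x) := funext hsplit
  have hER : ∫ ω, (φ 1 + c * (R ω - 1)) ∂μ = φ 1 := by
    have hsub : Integrable (fun ω => R ω - 1) μ := hRi.sub (integrable_const 1)
    rw [integral_add (integrable_const _) (hsub.const_mul c),
      integral_const_mul, integral_sub hRi (integrable_const 1), hR1']
    simp
  have hEE : ∫ x in Ioi (0 : ℝ), (φ 1 + c * (x - 1)) * Real.exp (-x) = φ 1 := by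
    have h : (fun x : ℝ => (φ 1 + c * (x - 1)) * Real.exp (-x)) = fun x =>
        φ 1 * Real.exp (-x) + c * ((x - 1) * Real.exp (-x)) := by
      ext x
      ring
    rw [h, integral_add ((integrableOn_exp_neg_Ioi 0).const_mul _)
      ((integrableOn_sub_mul_exp_neg_Ioi 1).const_mul c), integral_const_mul, integral_const_mul,
      integral_exp_neg_Ioi_zero, integral_sub_mul_exp_neg_Ioi 1 le_rfl]
    simp
  have hφRi : Integrable (fun ω => φ (R ω)) μ := by
    rw [hφR]
    exact hψR.add hlinR
  have hφEi : Integrable (fun x => φ x * Real.exp (-x)) (volume.restrict (Ioi 0)) := by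
    rw [hφE]
    exact hψi.add hlin
  refine lintegral_pos_add_neg_le_of_integral_le hφRi hφEi ?_
  rw [hφR, hφE, integral_add hψR hlinR, integral_add hψi hlin, hER, hEE]
  linarith
end

section
/- Let Z be a random variable taking values in the positive integers together with the symbol ∞, on a probability space (Ω, F, P), and let (F_n)_{n≥0} be a filtration with F_∞ = σ(∪_n F_n). Define Y = P(Z = ∞ | F_∞) + Σ_{n=1}^∞ P(Z = n | F_{n−1}). Then Y is dominated in the convex order by a mean-one exponential random variable: for every convex function φ : ℝ → ℝ, E[φ(Y)] ≤ ∫_0^∞ φ(x) e^{-x} dx. -/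
open MeasureTheory Filter Set
open scoped ENNReal

/-- A convex function on the line is the integral of a monotone function. -/
lemma ConvexOn.exists_monotone_eq_integral {φ : ℝ → ℝ} (hφ : ConvexOn ℝ univ φ) :
    ∃ g : ℝ → ℝ, Monotone g ∧ ∀ x, 0 ≤ x → φ x = φ 0 + ∫ t in (0 : ℝ)..x, g t := by
  have hmono : Monotone fun x ↦ derivWithin φ (Ioi x) x := by
    simpa [monotoneOn_univ] using hφ.monotoneOn_rightDeriv
  refine ⟨_, hmono, fun x hx ↦ ?_⟩
  have hcont : Continuous φ := by
    simpa [continuousOn_univ] using hφ.continuousOn isOpen_univ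
  rw [intervalIntegral.integral_eq_sub_of_hasDeriv_right hcont.continuousOn
    (fun t _ ↦ hφ.hasDerivWithinAt_rightDeriv_of_mem_interior (by simp))
    hmono.intervalIntegrable]
  ring

lemma IsUpperSet.exists_Ioi_ae_eq_inter {U : Set ℝ} (hU : IsUpperSet U) (ν : Measure ℝ)
    [NullSingletonClass ν] :
    U ∩ Ioi 0 = ∅ ∨ ∃ a, 0 ≤ a ∧ (U ∩ Ioi 0 : Set ℝ) =ᵐ[ν] Ioi a := by
  rcases (U ∩ Ioi (0 : ℝ)).eq_empty_or_nonempty with h | h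
  · exact Or.inl h
  have hbdd : BddBelow (U ∩ Ioi (0 : ℝ)) := ⟨0, fun x hx ↦ hx.2.le⟩
  refine Or.inr ⟨sInf (U ∩ Ioi 0), le_csInf h fun x hx ↦ hx.2.le, ?_⟩
  have h₁ : Ioi (sInf (U ∩ Ioi 0)) ⊆ U ∩ Ioi 0 := fun x hx ↦ by
    obtain ⟨y, hy, hyx⟩ := exists_lt_of_csInf_lt h hx
    exact ⟨hU hyx.le hy.1, hy.2.trans hyx⟩
  have h₂ : U ∩ Ioi 0 ⊆ Ici (sInf (U ∩ Ioi 0)) := fun x hx ↦ csInf_le hbdd hx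
  exact (h₂.eventuallyLE.trans Ioi_ae_eq_Ici.symm.le).antisymm h₁.eventuallyLE

/-- Domination of upper tails gives domination of the integrals of monotone functions. -/
lemma setLIntegral_Ioi_mono_of_tail_le {ν₁ ν₂ : Measure ℝ} [NullSingletonClass ν₁]
    [NullSingletonClass ν₂]
    (h : ∀ a, 0 ≤ a → ν₁ (Ioi a) ≤ ν₂ (Ioi a)) {g : ℝ → ℝ} (hg : Monotone g) (hg0 : 0 ≤ g 0) :
    ∫⁻ t in Ioi 0, ENNReal.ofReal (g t) ∂ν₁ ≤ ∫⁻ t in Ioi 0, ENNReal.ofReal (g t) ∂ν₂ := by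
  have hnn (ν : Measure ℝ) : 0 ≤ᵐ[ν.restrict (Ioi 0)] g :=
    ae_restrict_of_forall_mem measurableSet_Ioi fun t ht ↦ hg0.trans (hg (le_of_lt ht))
  rw [lintegral_eq_lintegral_meas_lt _ (hnn ν₁) hg.measurable.aemeasurable,
    lintegral_eq_lintegral_meas_lt _ (hnn ν₂) hg.measurable.aemeasurable]
  refine lintegral_mono fun u ↦ ?_
  have hm : MeasurableSet {t | u < g t} := measurableSet_lt measurable_const hg.measurable
  have hU : IsUpperSet {t | u < g t} := fun a b hab (ha : u < g a) ↦ ha.trans_le (hg hab)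
  rw [Measure.restrict_apply hm, Measure.restrict_apply hm]
  have : NullSingletonClass (ν₁ + ν₂) := ⟨fun x ↦ by simp⟩
  rcases hU.exists_Ioi_ae_eq_inter (ν₁ + ν₂) with h0 | ⟨a, ha, hae⟩
  · simp [h0]
  · rw [measure_congr (ae_mono (Measure.le_add_right le_rfl) hae),
      measure_congr (ae_mono (Measure.le_add_left le_rfl) hae)]
    exact h a ha

lemma setLIntegral_Ioi_exp_neg (a : ℝ) :
    ∫⁻ s in Ioi a, ENNReal.ofReal (Real.exp (-s)) = ENNReal.ofReal (Real.exp (-a)) := by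
  rw [← integral_exp_neg_Ioi a, ofReal_integral_eq_lintegral_ofReal (integrableOn_exp_neg_Ioi a)
    (ae_of_all _ fun _ ↦ (Real.exp_pos _).le)]

/-- The stop-loss transform is the integrated tail. -/
lemma lintegral_ofReal_sub_eq {Ω : Type*} {m : MeasurableSpace Ω} (μ : Measure Ω) {X : Ω → ℝ}
    (hX : AEMeasurable X μ) (a : ℝ) :
    ∫⁻ ω, ENNReal.ofReal (X ω - a) ∂μ = ∫⁻ s in Ioi a, μ {ω | s < X ω} := by
  have h := lintegral_eq_lintegral_meas_lt μ (f := fun ω ↦ max (X ω - a) 0)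
    (ae_of_all _ fun _ ↦ le_max_right _ _) ((hX.sub_const a).max aemeasurable_const)
  have hpre : (fun s : ℝ ↦ s + a) ⁻¹' Ioi a = Ioi 0 := by ext; simp
  have hshift := (measurePreserving_add_right (volume : Measure ℝ) a).setLIntegral_comp_preimage_emb
    (measurableEmbedding_addRight a) (fun s ↦ μ {ω | s < X ω}) (Ioi a)
  rw [hpre] at hshift
  rw [← hshift]
  simp only [ENNReal.ofReal_max, ENNReal.ofReal_zero, max_zero] at h
  rw [h]
  refine setLIntegral_congr_fun measurableSet_Ioi fun s hs ↦ ?_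
  have hs : 0 < s := hs
  congr 1
  ext ω
  simp [lt_sub_iff_add_lt, hs.not_gt]

/-- A stop-loss transform dominated by the tail decays exponentially. -/
lemma lintegral_ofReal_sub_le_exp {Ω : Type*} {m : MeasurableSpace Ω} (μ : Measure Ω)
    [IsProbabilityMeasure μ] {X : Ω → ℝ} (hX : AEMeasurable X μ)
    (h : ∀ t, 0 ≤ t → ∫⁻ ω, ENNReal.ofReal (X ω - t) ∂μ ≤ μ {ω | t < X ω})
    {t : ℝ} (ht : 0 ≤ t) :
    ∫⁻ ω, ENNReal.ofReal (X ω - t) ∂μ ≤ ENNReal.ofReal (Real.exp (-t)) := by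
  have hstep (s δ : ℝ) (hs : 0 ≤ s) (hδ : 0 ≤ δ) :
      ENNReal.ofReal (1 + δ) * ∫⁻ ω, ENNReal.ofReal (X ω - (s + δ)) ∂μ
        ≤ ∫⁻ ω, ENNReal.ofReal (X ω - s) ∂μ := by
    have hnull : NullMeasurableSet {ω | s + δ < X ω} μ := nullMeasurableSet_lt aemeasurable_const hX
    calc ENNReal.ofReal (1 + δ) * ∫⁻ ω, ENNReal.ofReal (X ω - (s + δ)) ∂μ
        ≤ ∫⁻ ω, ENNReal.ofReal (X ω - (s + δ)) ∂μ + ENNReal.ofReal δ * μ {ω | s + δ < X ω} := by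
          rw [ENNReal.ofReal_add zero_le_one hδ, add_mul, ENNReal.ofReal_one, one_mul]
          gcongr
          exact h _ (by positivity)
      _ = ∫⁻ ω, (ENNReal.ofReal (X ω - (s + δ))
            + {ω | s + δ < X ω}.indicator (fun _ ↦ ENNReal.ofReal δ) ω) ∂μ := by
          rw [lintegral_add_left' (hX.sub_const _).ennreal_ofReal, lintegral_indicator_const₀ hnull]
      _ ≤ _ := by
          refine lintegral_mono fun ω ↦ ?_
          by_cases hω : s + δ < X ω
          · simp only [mem_ofPred_eq, hω, indicator_of_mem]
            rw [← ENNReal.ofReal_add (by linarith) hδ]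
            exact ENNReal.ofReal_le_ofReal (by linarith)
          · simp only [mem_ofPred_eq, hω, not_false_eq_true, indicator_of_notMem, add_zero]
            exact ENNReal.ofReal_le_ofReal (by linarith)
  have hiter (δ : ℝ) (hδ : 0 ≤ δ) (n : ℕ) :
      ENNReal.ofReal ((1 + δ) ^ n) * ∫⁻ ω, ENNReal.ofReal (X ω - n * δ) ∂μ ≤ 1 := by
    induction n with
    | zero => simpa using (h 0 le_rfl).trans prob_le_one
    | succ n ih =>
      refine le_trans ?_ ih
      rw [pow_succ, ENNReal.ofReal_mul (by positivity), mul_assoc]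
      gcongr
      have := hstep (n * δ) δ (by positivity) hδ
      rwa [← add_one_mul, ← Nat.cast_add_one] at this
  have hfin : ∫⁻ ω, ENNReal.ofReal (X ω - t) ∂μ ≠ ∞ :=
    ne_top_of_le_ne_top ENNReal.one_ne_top ((h t ht).trans prob_le_one)
  have hlim := ENNReal.Tendsto.mul_const
    (ENNReal.tendsto_ofReal (Real.tendsto_one_add_div_pow_exp t)) (Or.inr hfin)
  have hle : ENNReal.ofReal (Real.exp t) * ∫⁻ ω, ENNReal.ofReal (X ω - t) ∂μ ≤ 1 := by
    refine le_of_tendsto hlim (eventually_gt_atTop 0 |>.mono fun n hn ↦ ?_)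
    have hn' : (n : ℝ) ≠ 0 := by positivity
    simpa [mul_div_cancel₀ _ hn'] using hiter (t / n) (by positivity) n
  rw [Real.exp_neg, ENNReal.ofReal_inv_of_pos (Real.exp_pos t), ENNReal.le_inv_iff_mul_le, mul_comm]
  exact hle

/-- An exponentially decaying stop-loss transform dominates the expectation of the primitive of a
nonnegative monotone function by that under the exponential distribution. -/
lemma lintegral_primitive_le_exp {Ω : Type*} {m : MeasurableSpace Ω} (μ : Measure Ω)
    {X : Ω → ℝ} (hX : AEMeasurable X μ) (hX0 : 0 ≤ᵐ[μ] X)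
    (h : ∀ t, 0 ≤ t → ∫⁻ ω, ENNReal.ofReal (X ω - t) ∂μ ≤ ENNReal.ofReal (Real.exp (-t)))
    {g : ℝ → ℝ} (hg : Monotone g) (hg0 : 0 ≤ g 0) :
    ∫⁻ ω, ENNReal.ofReal (∫ t in (0 : ℝ)..X ω, g t) ∂μ
      ≤ ∫⁻ x in Ioi (0 : ℝ), ENNReal.ofReal ((∫ t in (0 : ℝ)..x, g t) * Real.exp (-x)) := by
  have hgnn : ∀ᵐ t ∂volume.restrict (Ioi (0 : ℝ)), 0 ≤ g t :=
    ae_restrict_of_forall_mem measurableSet_Ioi fun t ht ↦ hg0.trans (hg (le_of_lt ht))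
  have hexp : Measurable fun x : ℝ ↦ ENNReal.ofReal (Real.exp (-x)) := by fun_prop
  have htail : Measurable fun t : ℝ ↦ μ {ω | t < X ω} :=
    Antitone.measurable fun s t hst ↦ measure_mono fun ω (hω : t < X ω) ↦ hst.trans_lt hω
  set ν := (volume.restrict (Ioi (0 : ℝ))).withDensity fun x ↦ ENNReal.ofReal (Real.exp (-x))
    with hν
  have hν0 : 0 ≤ᵐ[ν] fun x : ℝ ↦ x :=
    (withDensity_absolutelyContinuous _ _).ae_le
      (ae_restrict_of_forall_mem measurableSet_Ioi fun t ht ↦ le_of_lt ht)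
  have hright : ∫⁻ x in Ioi (0 : ℝ), ENNReal.ofReal ((∫ t in (0 : ℝ)..x, g t) * Real.exp (-x))
      = ∫⁻ x, ENNReal.ofReal (∫ t in (0 : ℝ)..x, g t) ∂ν := by
    have hmeas : Measurable fun x : ℝ ↦ ∫ t in (0 : ℝ)..x, g t :=
      (intervalIntegral.continuous_primitive (fun a b ↦ hg.intervalIntegrable) 0).measurable
    rw [hν, lintegral_withDensity_eq_lintegral_mul _ hexp hmeas.ennreal_ofReal]
    refine lintegral_congr fun x ↦ ?_
    rw [ENNReal.ofReal_mul' (Real.exp_pos _).le, mul_comm]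
    rfl
  rw [hright, lintegral_comp_eq_lintegral_meas_lt_mul μ hX0 hX (fun _ _ ↦ hg.intervalIntegrable)
    hgnn, lintegral_comp_eq_lintegral_meas_lt_mul ν hν0 aemeasurable_id
    (fun _ _ ↦ hg.intervalIntegrable) hgnn]
  have hνtail : ∀ t ∈ Ioi (0 : ℝ), ν {x | t < x} * ENNReal.ofReal (g t)
      = ENNReal.ofReal (Real.exp (-t)) * ENNReal.ofReal (g t) := fun t ht ↦ by
    have ht : 0 < t := ht
    change ν (Ioi t) * _ = _
    rw [hν, withDensity_apply _ measurableSet_Ioi, Measure.restrict_restrict measurableSet_Ioi,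
      inter_eq_left.mpr (Ioi_subset_Ioi ht.le), setLIntegral_Ioi_exp_neg]
  rw [setLIntegral_congr_fun measurableSet_Ioi hνtail]
  have hmono := setLIntegral_Ioi_mono_of_tail_le
    (ν₁ := volume.withDensity fun t ↦ μ {ω | t < X ω})
    (ν₂ := volume.withDensity fun x : ℝ ↦ ENNReal.ofReal (Real.exp (-x))) (fun a ha ↦ by
      rw [withDensity_apply _ measurableSet_Ioi, withDensity_apply _ measurableSet_Ioi,
        setLIntegral_Ioi_exp_neg, ← lintegral_ofReal_sub_eq μ hX]
      exact h a ha) hg hg0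
  rwa [setLIntegral_withDensity_eq_setLIntegral_mul _ htail hg.measurable.ennreal_ofReal
      measurableSet_Ioi, setLIntegral_withDensity_eq_setLIntegral_mul _ hexp
      hg.measurable.ennreal_ofReal measurableSet_Ioi] at hmono

/-- Positive and negative parts of the sum of a function and a nonnegative function. -/
lemma lintegral_pos_add_neg_eq_of_add {γ : Type*} {mγ : MeasurableSpace γ} {ρ : Measure γ}
    {f ℓ ψ : γ → ℝ}
    (hf : f =ᵐ[ρ] fun x ↦ ℓ x + ψ x) (hℓ : AEMeasurable ℓ ρ) (hψ : AEMeasurable ψ ρ)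
    (hψ0 : 0 ≤ᵐ[ρ] ψ) :
    ∫⁻ x, ENNReal.ofReal (f x) ∂ρ + ∫⁻ x, ENNReal.ofReal (-ℓ x) ∂ρ
      = ∫⁻ x, ENNReal.ofReal (-f x) ∂ρ + ∫⁻ x, ENNReal.ofReal (ℓ x) ∂ρ
        + ∫⁻ x, ENNReal.ofReal (ψ x) ∂ρ := by
  rw [← lintegral_add_right' _ hℓ.fun_neg.ennreal_ofReal, ← lintegral_add_right' _ hℓ.ennreal_ofReal,
    ← lintegral_add_right' _ hψ.ennreal_ofReal]
  refine lintegral_congr_ae ?_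
  filter_upwards [hf, hψ0] with x hx h0
  have h0 : 0 ≤ ψ x := h0
  rw [← ENNReal.toReal_eq_toReal_iff' (by finiteness) (by finiteness),
    ENNReal.toReal_add (by finiteness) (by finiteness),
    ENNReal.toReal_add (by finiteness) (by finiteness),
    ENNReal.toReal_add (by finiteness) (by finiteness)]
  simp only [ENNReal.toReal_ofReal_eq_iff.mpr h0, ENNReal.toReal_ofReal', hx]
  simp only [max_def]
  split_ifs <;> linarith

/-- Comparison of possibly infinite expectations of functions that are sums of integrable functions
with equal integrals and of nonnegative functions with ordered integrals. -/
lemma lintegral_pos_add_neg_le_of_add {α β : Type*} {mα : MeasurableSpace α}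
    {mβ : MeasurableSpace β} {μ : Measure α} {ν : Measure β} {f ℓ ψ : α → ℝ} {f' ℓ' ψ' : β → ℝ}
    (hf : f =ᵐ[μ] fun x ↦ ℓ x + ψ x) (hf' : f' =ᵐ[ν] fun x ↦ ℓ' x + ψ' x)
    (hℓ : Integrable ℓ μ) (hℓ' : Integrable ℓ' ν) (hintegral : ∫ x, ℓ x ∂μ = ∫ x, ℓ' x ∂ν)
    (hψ : AEMeasurable ψ μ) (hψ' : AEMeasurable ψ' ν) (hψ0 : 0 ≤ᵐ[μ] ψ) (hψ0' : 0 ≤ᵐ[ν] ψ')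
    (hle : ∫⁻ x, ENNReal.ofReal (ψ x) ∂μ ≤ ∫⁻ x, ENNReal.ofReal (ψ' x) ∂ν) :
    ∫⁻ x, ENNReal.ofReal (f x) ∂μ + ∫⁻ x, ENNReal.ofReal (-f' x) ∂ν
      ≤ ∫⁻ x, ENNReal.ofReal (f' x) ∂ν + ∫⁻ x, ENNReal.ofReal (-f x) ∂μ := by
  have h1 := lintegral_pos_add_neg_eq_of_add hf hℓ.aemeasurable hψ hψ0
  have h2 := lintegral_pos_add_neg_eq_of_add hf' hℓ'.aemeasurable hψ' hψ0'
  have ha := hℓ.lintegral_lt_top.ne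
  have hc := hℓ'.lintegral_lt_top.ne
  have hb := hℓ.neg.lintegral_lt_top.ne
  have hd := hℓ'.neg.lintegral_lt_top.ne
  simp only [Pi.neg_apply] at hb hd
  have h3 : ∫⁻ x, ENNReal.ofReal (ℓ x) ∂μ + ∫⁻ x, ENNReal.ofReal (-ℓ' x) ∂ν
      = ∫⁻ x, ENNReal.ofReal (ℓ' x) ∂ν + ∫⁻ x, ENNReal.ofReal (-ℓ x) ∂μ := by
    rw [integral_eq_lintegral_pos_part_sub_lintegral_neg_part hℓ,
      integral_eq_lintegral_pos_part_sub_lintegral_neg_part hℓ'] at hintegral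
    rw [← ENNReal.toReal_eq_toReal_iff' (ENNReal.add_ne_top.mpr ⟨ha, hd⟩)
      (ENNReal.add_ne_top.mpr ⟨hc, hb⟩), ENNReal.toReal_add ha hd,
      ENNReal.toReal_add hc hb]
    linarith
  rw [← ENNReal.add_le_add_iff_right (ENNReal.add_ne_top.mpr ⟨hb, hd⟩)]
  calc _ = (∫⁻ x, ENNReal.ofReal (f x) ∂μ + ∫⁻ x, ENNReal.ofReal (-ℓ x) ∂μ)
          + (∫⁻ x, ENNReal.ofReal (-f' x) ∂ν + ∫⁻ x, ENNReal.ofReal (-ℓ' x) ∂ν) := by ring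
    _ = (∫⁻ x, ENNReal.ofReal (ℓ x) ∂μ + ∫⁻ x, ENNReal.ofReal (-ℓ' x) ∂ν)
          + ∫⁻ x, ENNReal.ofReal (-f x) ∂μ + ∫⁻ x, ENNReal.ofReal (-f' x) ∂ν
          + ∫⁻ x, ENNReal.ofReal (ψ x) ∂μ := by rw [h1]; ring
    _ ≤ (∫⁻ x, ENNReal.ofReal (ℓ' x) ∂ν + ∫⁻ x, ENNReal.ofReal (-ℓ x) ∂μ)
          + ∫⁻ x, ENNReal.ofReal (-f x) ∂μ + ∫⁻ x, ENNReal.ofReal (-f' x) ∂ν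
          + ∫⁻ x, ENNReal.ofReal (ψ' x) ∂ν := by rw [h3]; gcongr
    _ = (∫⁻ x, ENNReal.ofReal (-f' x) ∂ν + ∫⁻ x, ENNReal.ofReal (ℓ' x) ∂ν
          + ∫⁻ x, ENNReal.ofReal (ψ' x) ∂ν)
          + (∫⁻ x, ENNReal.ofReal (-f x) ∂μ + ∫⁻ x, ENNReal.ofReal (-ℓ x) ∂μ) := by ring
    _ = _ := by rw [← h2]; ring

/-- A nonnegative random variable with mean one whose stop-loss transform is dominated by its tail
is below the mean-one exponential distribution in the convex order. -/
lemma convexOrder_exp_of_stopLoss_le_tail {Ω : Type*} {m : MeasurableSpace Ω} (μ : Measure Ω)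
    [IsProbabilityMeasure μ] {X : Ω → ℝ} (hX : AEMeasurable X μ) (hX0 : 0 ≤ᵐ[μ] X)
    (hmean : ∫⁻ ω, ENNReal.ofReal (X ω) ∂μ = 1)
    (h : ∀ t, 0 ≤ t → ∫⁻ ω, ENNReal.ofReal (X ω - t) ∂μ ≤ μ {ω | t < X ω})
    {φ : ℝ → ℝ} (hφ : ConvexOn ℝ univ φ) :
    ∫⁻ ω, ENNReal.ofReal (φ (X ω)) ∂μ
        + ∫⁻ x in Ioi (0 : ℝ), ENNReal.ofReal (-(φ x * Real.exp (-x)))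
      ≤ (∫⁻ x in Ioi (0 : ℝ), ENNReal.ofReal (φ x * Real.exp (-x)))
        + ∫⁻ ω, ENNReal.ofReal (-φ (X ω)) ∂μ := by
  obtain ⟨g, hg, hφg⟩ := hφ.exists_monotone_eq_integral
  have hg' : Monotone fun t ↦ g t - g 0 := fun s t hst ↦ sub_le_sub_right (hg hst) _
  have hcont : Continuous fun x : ℝ ↦ ∫ t in (0 : ℝ)..x, (g t - g 0) :=
    intervalIntegral.continuous_primitive (fun a b ↦ hg'.intervalIntegrable) 0
  have hψ0 (x : ℝ) (hx : 0 ≤ x) : 0 ≤ ∫ t in (0 : ℝ)..x, (g t - g 0) :=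
    intervalIntegral.integral_nonneg hx fun t ht ↦ sub_nonneg.mpr (hg ht.1)
  have hdecomp (x : ℝ) (hx : 0 ≤ x) : φ x = φ 0 + g 0 * x + ∫ t in (0 : ℝ)..x, (g t - g 0) := by
    rw [hφg x hx, intervalIntegral.integral_sub hg.intervalIntegrable intervalIntegrable_const,
      intervalIntegral.integral_const, smul_eq_mul]
    ring
  have hXint : Integrable X μ :=
    (lintegral_ofReal_ne_top_iff_integrable hX.aestronglyMeasurable hX0).mp (by simp [hmean])
  have hXmean : ∫ ω, X ω ∂μ = 1 := by
    rw [integral_eq_lintegral_of_nonneg_ae hX0 hX.aestronglyMeasurable, hmean, ENNReal.toReal_one]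
  have hexpint : IntegrableOn (fun x : ℝ ↦ Real.exp (-x)) (Ioi 0) := integrableOn_exp_neg_Ioi 0
  have hxexpint : IntegrableOn (fun x : ℝ ↦ x * Real.exp (-x)) (Ioi 0) := by
    have := Real.GammaIntegral_convergent (s := 2) two_pos
    refine this.congr_fun (fun x _ ↦ ?_) measurableSet_Ioi
    norm_num [mul_comm]
  have hxexpmean : ∫ x in Ioi (0 : ℝ), x * Real.exp (-x) = 1 := by
    rw [← Real.Gamma_two, Real.Gamma_eq_integral two_pos]
    refine setIntegral_congr_fun measurableSet_Ioi fun x _ ↦ ?_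
    norm_num [mul_comm]
  refine lintegral_pos_add_neg_le_of_add
    (ℓ := fun ω ↦ φ 0 + g 0 * X ω) (ψ := fun ω ↦ ∫ t in (0 : ℝ)..X ω, (g t - g 0))
    (ℓ' := fun x ↦ φ 0 * Real.exp (-x) + g 0 * (x * Real.exp (-x)))
    (ψ' := fun x ↦ (∫ t in (0 : ℝ)..x, (g t - g 0)) * Real.exp (-x))
    ?_ ?_ ((integrable_const _).add (hXint.const_mul _))
    ((hexpint.const_mul _).add (hxexpint.const_mul _)) ?_ (hcont.measurable.comp_aemeasurable hX)
    (hcont.measurable.mul (by fun_prop)).aemeasurable ?_ ?_ ?_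
  · filter_upwards [hX0] with ω hω using hdecomp _ hω
  · refine ae_restrict_of_forall_mem measurableSet_Ioi fun x hx ↦ ?_
    simp only [hdecomp x (le_of_lt hx)]
    ring
  · rw [integral_add (integrable_const _) (hXint.const_mul _),
      integral_add (hexpint.const_mul _) (hxexpint.const_mul _)]
    simp only [integral_const_mul, integral_const, hXmean, hxexpmean, integral_exp_neg_Ioi_zero,
      probReal_univ, one_smul, mul_one]
  · filter_upwards [hX0] with ω hω using hψ0 _ hω
  · exact ae_restrict_of_forall_mem measurableSet_Ioi fun x hx ↦
      mul_nonneg (hψ0 x (le_of_lt hx)) (Real.exp_pos _).le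
  · exact lintegral_primitive_le_exp μ hX hX0
      (fun t ht ↦ lintegral_ofReal_sub_le_exp μ hX h ht) hg' (by simp)

/-- Garsia-type bound: if the conditional remaining mass of a nonnegative series with a terminal
term is at most one, then its stop-loss transform is dominated by its tail. -/
lemma lintegral_tsub_le_measure_lt_of_remainder_le {Ω : Type*} {m : MeasurableSpace Ω}
    (μ : Measure Ω) (ℱ : Filtration ℕ m) {P : ℕ → Ω → ℝ≥0∞} {Q : Ω → ℝ≥0∞}
    (hP : ∀ n, Measurable[ℱ n] (P n)) (hQ : Measurable Q) (hQ1 : ∀ᵐ ω ∂μ, Q ω ≤ 1)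
    (hrem : ∀ n A, MeasurableSet[ℱ n] A → ∫⁻ ω in A, (Q ω + ∑' k, P (k + n) ω) ∂μ ≤ μ A)
    (t : ℝ≥0∞) :
    ∫⁻ ω, (Q ω + ∑' k, P k ω - t) ∂μ ≤ μ {ω | t < Q ω + ∑' k, P k ω} := by
  have hPm (n : ℕ) : Measurable (P n) := (hP n).mono (ℱ.le n) le_rfl
  set S : ℕ → Ω → ℝ≥0∞ := fun n ω ↦ ∑ k ∈ Finset.range n, P k ω with hS
  have hSmono (ω : Ω) : Monotone fun n ↦ S n ω := fun i j hij ↦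
    Finset.sum_le_sum_of_subset (Finset.range_mono hij)
  have hSm (n j : ℕ) (hj : j ≤ n + 1) : Measurable[ℱ n] (S j) :=
    Finset.measurable_fun_sum _ fun k hk ↦
      (hP k).mono (ℱ.mono (by have := Finset.mem_range.mp hk; lia)) le_rfl
  have hsplit (n : ℕ) (ω : Ω) : ∑' k, P k ω = S n ω + ∑' k, P (k + n) ω :=
    (ENNReal.summable.sum_add_tsum_nat_add' (f := fun k ↦ P k ω)).symm
  have hSle (n : ℕ) (ω : Ω) : S n ω ≤ ∑' k, P k ω := by rw [hsplit n]; exact le_self_add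
  set V : Ω → ℝ≥0∞ := fun ω ↦ Q ω + ∑' k, P k ω with hV
  have hVm : Measurable V := hQ.add (Measurable.tsum hPm)
  have hRm (n : ℕ) : Measurable fun ω ↦ Q ω + ∑' k, P (k + n) ω :=
    hQ.add (Measurable.tsum fun k ↦ hPm (k + n))
  let A : ℕ → Set Ω := fun n ↦ {ω | S n ω ≤ t} ∩ {ω | t < S (n + 1) ω}
  let B : Set Ω := (⋂ n, {ω | S n ω ≤ t}) ∩ {ω | t < V ω}
  have hAF (n : ℕ) : MeasurableSet[ℱ n] (A n) :=
    (measurableSet_le (hSm n n n.le_succ) measurable_const).inter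
      (measurableSet_lt measurable_const (hSm n (n + 1) le_rfl))
  have hA (n : ℕ) : MeasurableSet (A n) := ℱ.le n _ (hAF n)
  have hB : MeasurableSet B :=
    (MeasurableSet.iInter fun n ↦ measurableSet_le ((hSm n n n.le_succ).mono (ℱ.le n) le_rfl)
      measurable_const).inter (measurableSet_lt measurable_const hVm)
  have hAdisj : Pairwise (Function.onFun Disjoint A) := by
    refine (pairwise_disjoint_on A).mpr fun i j hij ↦ Set.disjoint_left.mpr fun ω hi hj ↦ ?_
    exact (hi.2.trans_le (hSmono ω (Nat.succ_le_of_lt hij))).not_ge hj.1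
  have hABdisj : Disjoint (⋃ n, A n) B := Set.disjoint_left.mpr fun ω hω hωB ↦ by
    obtain ⟨n, hn⟩ := mem_iUnion.mp hω
    have hle : S (n + 1) ω ≤ t := mem_iInter.mp hωB.1 (n + 1)
    exact hn.2.not_ge hle
  have hpt (ω : Ω) : V ω - t ≤
      ∑' n, (A n).indicator (fun ω ↦ Q ω + ∑' k, P (k + n) ω) ω + B.indicator Q ω := by
    by_cases hex : ∃ n, t < S n ω
    · classical
      obtain ⟨n, hn⟩ : ∃ n, ω ∈ A n := by
        obtain ⟨n, hn⟩ : ∃ n, Nat.find hex = n + 1 :=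
          Nat.exists_eq_succ_of_ne_zero fun h0 ↦ by simpa [h0, hS] using Nat.find_spec hex
        exact ⟨n, not_lt.mp (Nat.find_min hex (by lia)), hn ▸ Nat.find_spec hex⟩
      refine le_add_right (le_trans ?_ (ENNReal.le_tsum n))
      rw [indicator_of_mem hn, tsub_le_iff_right]
      calc V ω = Q ω + ∑' k, P (k + n) ω + S n ω := by rw [hV]; simp only; rw [hsplit n ω]; ring
        _ ≤ _ := by gcongr; exact hn.1
    · push Not at hex
      by_cases hlt : t < V ω
      · refine le_add_left ?_
        rw [indicator_of_mem (show ω ∈ B from ⟨mem_iInter.mpr hex, hlt⟩), tsub_le_iff_right]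
        have : ∑' k, P k ω ≤ t := by
          rw [ENNReal.tsum_eq_iSup_nat]
          exact iSup_le hex
        exact add_le_add_right this _
      · rw [tsub_eq_zero_of_le (not_lt.mp hlt)]
        exact zero_le
  calc ∫⁻ ω, (V ω - t) ∂μ
      ≤ ∫⁻ ω, (∑' n, (A n).indicator (fun ω ↦ Q ω + ∑' k, P (k + n) ω) ω + B.indicator Q ω) ∂μ :=
        lintegral_mono hpt
    _ = ∑' n, ∫⁻ ω in A n, (Q ω + ∑' k, P (k + n) ω) ∂μ + ∫⁻ ω in B, Q ω ∂μ := by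
        rw [lintegral_add_right _ (hQ.indicator hB), lintegral_tsum fun n ↦
          ((hRm n).indicator (hA n)).aemeasurable,
          lintegral_indicator hB]
        simp_rw [lintegral_indicator (hA _)]
    _ ≤ ∑' n, μ (A n) + μ B := by
        gcongr with n
        · exact hrem n _ (hAF n)
        · exact (lintegral_mono_ae (ae_restrict_of_ae hQ1)).trans_eq (setLIntegral_one B)
    _ = μ ((⋃ n, A n) ∪ B) := by
        rw [measure_union hABdisj hB, measure_iUnion hAdisj hA]
    _ ≤ _ := by
        refine measure_mono (union_subset (iUnion_subset fun n ω hω ↦ ?_) inter_subset_right)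
        exact hω.2.trans_le ((hSle (n + 1) ω).trans le_add_self)

lemma setLIntegral_ofReal_condExp_indicator {Ω : Type*} {m' m : MeasurableSpace Ω}
    (μ : Measure Ω) [IsFiniteMeasure μ] (hm : m' ≤ m) {s A : Set Ω} (hs : MeasurableSet s)
    (hA : MeasurableSet[m'] A) :
    ∫⁻ ω in A, ENNReal.ofReal ((μ[s.indicator (fun _ ↦ (1 : ℝ)) | m']) ω) ∂μ = μ (A ∩ s) := by
  have hintegral : Integrable (s.indicator fun _ ↦ (1 : ℝ)) μ := (integrable_const 1).indicator hs
  have hnn : 0 ≤ᵐ[μ] μ[s.indicator (fun _ ↦ (1 : ℝ)) | m'] :=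
    condExp_nonneg (ae_of_all _ fun ω ↦ indicator_nonneg (fun _ _ ↦ zero_le_one) ω)
  rw [← ofReal_integral_eq_lintegral_ofReal integrable_condExp.integrableOn
      (ae_restrict_of_ae hnn), setIntegral_condExp hm hintegral hA, setIntegral_indicator hs,
    setIntegral_const, smul_eq_mul, mul_one, ofReal_measureReal]

lemma ENat.natCast_lt_iff_eq_top_or_eq_add {n : ℕ} {z : ℕ∞} :
    (n : ℕ∞) < z ↔ z = ⊤ ∨ ∃ k : ℕ, z = ((k + n + 1 : ℕ) : ℕ∞) := by
  induction z using ENat.recTopCoe with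
  | top => simp
  | coe j =>
    simp only [Nat.cast_lt, ENat.natCast_ne_top, false_or, Nat.cast_inj]
    exact ⟨fun h ↦ ⟨j - n - 1, by lia⟩, fun ⟨k, hk⟩ ↦ by lia⟩

/-- The mass of the total risk remaining after time `n` is that of the event `n < Z`. -/
lemma setLIntegral_remaining_risk {Ω : Type*} {m : MeasurableSpace Ω} (μ : Measure Ω)
    [IsFiniteMeasure μ] (ℱ : Filtration ℕ m) {Z : Ω → ℕ∞}
    (hZ : ∀ n : ℕ∞, MeasurableSet {ω | Z ω = n}) (n : ℕ) {A : Set Ω}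
    (hA : MeasurableSet[ℱ n] A) :
    ∫⁻ ω in A, (ENNReal.ofReal ((μ[indicator {ω' | Z ω' = ⊤} (fun _ ↦ (1 : ℝ)) |
          ⨆ k, (ℱ k : MeasurableSpace Ω)]) ω)
        + ∑' k, ENNReal.ofReal ((μ[indicator {ω' | Z ω' = ((k + n + 1 : ℕ) : ℕ∞)}
            (fun _ ↦ (1 : ℝ)) | ℱ (k + n)]) ω)) ∂μ
      = μ (A ∩ {ω | (n : ℕ∞) < Z ω}) := by
  have hsup : ⨆ k, (ℱ k : MeasurableSpace Ω) ≤ m := iSup_le ℱ.le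
  have hAm : MeasurableSet A := ℱ.le n _ hA
  have hmeas (k : ℕ) (s : Set Ω) : Measurable fun ω ↦
      ENNReal.ofReal ((μ[s.indicator (fun _ ↦ (1 : ℝ)) | ℱ k]) ω) :=
    (stronglyMeasurable_condExp.measurable.mono (ℱ.le k) le_rfl).ennreal_ofReal
  have hset : A ∩ {ω | (n : ℕ∞) < Z ω}
      = A ∩ {ω | Z ω = ⊤} ∪ ⋃ k : ℕ, A ∩ {ω | Z ω = ((k + n + 1 : ℕ) : ℕ∞)} := by
    rw [← inter_iUnion, ← inter_union_distrib_left]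
    congr 1
    ext ω
    simp only [mem_ofPred_eq, mem_union, mem_iUnion, ENat.natCast_lt_iff_eq_top_or_eq_add]
  rw [lintegral_add_right _ (Measurable.tsum fun k ↦ hmeas _ _),
    lintegral_tsum fun k ↦ (hmeas _ _).aemeasurable,
    setLIntegral_ofReal_condExp_indicator μ hsup (hZ ⊤) (le_iSup (fun k ↦ ℱ k) n _ hA), hset,
    measure_union, measure_iUnion]
  · congr 1
    exact tsum_congr fun k ↦ setLIntegral_ofReal_condExp_indicator μ (ℱ.le _) (hZ _)
      (ℱ.mono (Nat.le_add_left n k) _ hA)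
  · refine fun i j hij ↦ Set.disjoint_left.mpr fun ω hi hj ↦ hij ?_
    have := hi.2.symm.trans hj.2
    simpa using this
  · exact fun k ↦ hAm.inter (hZ _)
  · refine Set.disjoint_left.mpr fun ω hi hj ↦ ?_
    obtain ⟨k, hk⟩ := mem_iUnion.mp hj
    exact ENat.natCast_ne_top _ (hk.2.symm.trans hi.2)
  · exact MeasurableSet.iUnion fun k ↦ hAm.inter (hZ _)

/-- **Total risk for a possibly infinite random time.**
Let `Z` take values in the positive integers together with `∞` (modelled by `ℕ∞`), let
`ℱ` be a filtration and `ℱ_∞ = ⨆ n, ℱ n`.  Let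
`Y = P(Z = ∞ | ℱ_∞) + ∑_{n=1}^∞ P(Z = n | ℱ (n−1))`.  Then `Y` is dominated in the
convex order by a mean-one exponential random variable: for every convex `φ : ℝ → ℝ`,
`E[φ(Y)] ≤ ∫_0^∞ φ(x) e^{-x} dx`, both sides possibly infinite.  The inequality of
possibly-infinite expectations `E[f] ≤ E[g]` is encoded as
`E[f⁺] + E[g⁻] ≤ E[g⁺] + E[f⁻]` using lower Lebesgue integrals. -/
theorem total_risk_infinite_time_convex_order
    {Ω : Type*} {m : MeasurableSpace Ω} (μ : Measure Ω) [IsProbabilityMeasure μ]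
    (ℱ : Filtration ℕ m) (Z : Ω → ℕ∞)
    (hZmeas : ∀ n : ℕ∞, MeasurableSet {ω | Z ω = n})
    (hZpos : ∀ ω, Z ω ≠ 0)
    (Y : Ω → ℝ)
    (hY : Y = fun ω =>
      (μ[Set.indicator {ω' | Z ω' = ⊤} (fun _ => (1 : ℝ)) |
          (⨆ n, (ℱ n : MeasurableSpace Ω))]) ω
        + ∑' n : ℕ,
            (μ[Set.indicator {ω' | Z ω' = ((n + 1 : ℕ) : ℕ∞)} (fun _ => (1 : ℝ)) | ℱ n]) ω) :
    ∀ φ : ℝ → ℝ, ConvexOn ℝ Set.univ φ →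
      (∫⁻ ω, ENNReal.ofReal (φ (Y ω)) ∂μ)
          + (∫⁻ x in Set.Ioi (0 : ℝ), ENNReal.ofReal (-(φ x * Real.exp (-x))))
        ≤ (∫⁻ x in Set.Ioi (0 : ℝ), ENNReal.ofReal (φ x * Real.exp (-x)))
          + (∫⁻ ω, ENNReal.ofReal (-(φ (Y ω))) ∂μ) := by
  intro φ hφ
  set p : ℕ → Ω → ℝ := fun n ↦
    μ[indicator {ω' | Z ω' = ((n + 1 : ℕ) : ℕ∞)} (fun _ ↦ (1 : ℝ)) | ℱ n]
  set q : Ω → ℝ := μ[indicator {ω' | Z ω' = ⊤} (fun _ ↦ (1 : ℝ)) |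
    ⨆ n, (ℱ n : MeasurableSpace Ω)]
  have hind (s : Set Ω) (ω : Ω) : 0 ≤ s.indicator (fun _ ↦ (1 : ℝ)) ω :=
    indicator_nonneg (fun _ _ ↦ zero_le_one) ω
  have hp0 : ∀ᵐ ω ∂μ, ∀ n, 0 ≤ p n ω := ae_all_iff.mpr fun n ↦
    condExp_nonneg (ae_of_all _ (hind _))
  have hq0 : 0 ≤ᵐ[μ] q := condExp_nonneg (ae_of_all _ (hind _))
  have hsup : ⨆ n, (ℱ n : MeasurableSpace Ω) ≤ m := iSup_le ℱ.le
  have hq1 : ∀ᵐ ω ∂μ, ENNReal.ofReal (q ω) ≤ 1 := by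
    have h := condExp_mono (m := ⨆ n, (ℱ n : MeasurableSpace Ω))
      ((integrable_const (1 : ℝ)).indicator (hZmeas ⊤)) (integrable_const (μ := μ) (1 : ℝ))
      (ae_of_all _ fun ω ↦ indicator_le_self' (fun _ _ ↦ zero_le_one) ω)
    rw [condExp_const hsup] at h
    filter_upwards [h] with ω hω
    simpa using hω
  have hpm (n : ℕ) : Measurable[ℱ n] fun ω ↦ ENNReal.ofReal (p n ω) :=
    stronglyMeasurable_condExp.measurable.ennreal_ofReal
  have hqm : Measurable fun ω ↦ ENNReal.ofReal (q ω) :=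
    (stronglyMeasurable_condExp.measurable.mono hsup le_rfl).ennreal_ofReal
  set V : Ω → ℝ≥0∞ := fun ω ↦ ENNReal.ofReal (q ω) + ∑' n, ENNReal.ofReal (p n ω) with hV
  have hVm : Measurable V :=
    hqm.add (Measurable.tsum fun n ↦ (hpm n).mono (ℱ.le n) le_rfl)
  have hVmean : ∫⁻ ω, V ω ∂μ = 1 := by
    have h := setLIntegral_remaining_risk μ ℱ hZmeas 0 MeasurableSet.univ
    have huniv : {ω | ((0 : ℕ) : ℕ∞) < Z ω} = univ :=
      eq_univ_of_forall fun ω ↦ pos_iff_ne_zero.mpr (hZpos ω)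
    rw [Measure.restrict_univ, huniv, univ_inter, measure_univ] at h
    exact h
  have hVtop : ∀ᵐ ω ∂μ, V ω < ∞ := ae_lt_top hVm (by simp [hVmean])
  have hYV : Y =ᵐ[μ] fun ω ↦ (V ω).toReal := by
    filter_upwards [hVtop, hp0, hq0] with ω hω hpω hqω
    have hqω : 0 ≤ q ω := hqω
    rw [hY]
    simp only [hV]
    rw [ENNReal.toReal_add ENNReal.ofReal_ne_top (ENNReal.add_lt_top.mp hω).2.ne,
      ENNReal.tsum_toReal_eq fun _ ↦ ENNReal.ofReal_ne_top, ENNReal.toReal_ofReal hqω]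
    simp_rw [ENNReal.toReal_ofReal (hpω _)]
    rfl
  have hofReal : ∀ᵐ ω ∂μ, ENNReal.ofReal (Y ω) = V ω := by
    filter_upwards [hYV, hVtop] with ω h hω
    rw [h, ENNReal.ofReal_toReal hω.ne]
  refine convexOrder_exp_of_stopLoss_le_tail μ (hVm.ennreal_toReal.aemeasurable.congr hYV.symm)
    ?_ ((lintegral_congr_ae hofReal).trans hVmean) (fun t ht ↦ ?_) hφ
  · filter_upwards [hYV] with ω h
    rw [h]
    exact ENNReal.toReal_nonneg
  calc ∫⁻ ω, ENNReal.ofReal (Y ω - t) ∂μ = ∫⁻ ω, (V ω - ENNReal.ofReal t) ∂μ := by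
        refine lintegral_congr_ae ?_
        filter_upwards [hofReal] with ω h
        rw [ENNReal.ofReal_sub _ ht, h]
    _ ≤ μ {ω | ENNReal.ofReal t < V ω} :=
        lintegral_tsub_le_measure_lt_of_remainder_le μ ℱ hpm hqm hq1 (fun n A hA ↦
          (setLIntegral_remaining_risk μ ℱ hZmeas n hA).trans_le (measure_mono inter_subset_left)) _
    _ = μ {ω | t < Y ω} := by
        refine measure_congr ?_
        filter_upwards [hofReal] with ω h
        refine propext ?_
        change ENNReal.ofReal t < V ω ↔ t < Y ω
        rw [← h, ENNReal.ofReal_lt_ofReal_iff_of_nonneg ht]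
end
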